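/- arXiv:math/0606271 — 2 statements merged into one kernel-verified Lean document; each statement's English description precedes it below -/
import Mathlib

section
/- For all integers k, l ≥ 0 one has ω_p(v^k (v*)^l) = δ_{kl} λ^k (in particular ω_p(v^k) = 0 = ω_p((v*)^l) for k, l ≥ 1). -/
open Filter Topology
open scoped ComplexOrder

/-- Freeness of a pair of subsets `S`, `T` (thought of as the centered parts of two
subalgebras) with respect to a functional `φ`: `φ` vanishes on every nontrivial
alternating product with factors taken alternately from `S` and from `T`. -/
def FreeOn {A R : Type*} [Monoid A] [Zero R] (φ : A → R) (S T : Set A) : Prop :=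
  ∀ (n : ℕ) (y : Fin (n + 1) → A) (c : Fin (n + 1) → Bool),
    (∀ i, (c i = true → y i ∈ S) ∧ (c i = false → y i ∈ T)) →
    (∀ i : Fin n, c i.castSucc ≠ c i.succ) →
    φ (List.ofFn y).prod = 0

section Density

variable {H : Type*} [NormedAddCommGroup H] [InnerProductSpace ℂ H] [CompleteSpace H]

/-- A quantitative form of von Neumann's density theorem: operators in the bicommutant of a
star subalgebra are approximated by the subalgebra on finitely many vectors. -/
theorem exists_mem_norm_sub_lt_of_mem_bicommutant (A : StarSubalgebra ℂ (H →L[ℂ] H))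
    {y : H →L[ℂ] H} (hy : y ∈ Set.centralizer (Set.centralizer (A : Set (H →L[ℂ] H))))
    {ι : Type*} [Finite ι] (η : ι → H) {ε : ℝ} (hε : 0 < ε) :
    ∃ a ∈ A, ∀ i, ‖a (η i) - y (η i)‖ < ε := by
  classical
  have := Fintype.ofFinite ι
  let K := PiLp 2 (fun _ : ι => H)
  let π : ι → K →L[ℂ] H := fun i => PiLp.proj 2 (fun _ : ι => H) i
  let e : K ≃L[ℂ] (ι → H) := PiLp.continuousLinearEquiv 2 ℂ (fun _ : ι => H)
  let κ : ι → H →L[ℂ] K := fun j => (e.symm : (ι → H) →L[ℂ] K) ∘L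
    ContinuousLinearMap.single ℂ (fun _ : ι => H) j
  let D : (H →L[ℂ] H) → K →L[ℂ] K := fun T => (e.symm : (ι → H) →L[ℂ] K) ∘L
    ContinuousLinearMap.pi fun i => T ∘L π i
  have hπD : ∀ T i (ξ : K), π i (D T ξ) = T (π i ξ) := fun T i ξ => rfl
  have hκ : ∀ i j (ξ : H), π i (κ j ξ) = if i = j then ξ else 0 := by
    intro i j ξ
    change (Pi.single j ξ : ι → H) i = _
    simp [Pi.single_apply]
  have hext : ∀ ξ ζ : K, (∀ i, π i ξ = π i ζ) → ξ = ζ := fun ξ ζ h => PiLp.ext h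
  have hDκ : ∀ T j (ξ : H), D T (κ j ξ) = κ j (T ξ) := by
    intro T j ξ
    refine hext _ _ fun i => ?_
    rw [hπD, hκ, hκ]
    split_ifs <;> simp
  have hsum : ∀ ξ : K, ξ = ∑ j, κ j (π j ξ) := by
    intro ξ
    refine hext _ _ fun i => ?_
    simp [map_sum, hκ]
  let η' : K := e.symm η
  have hη' : ∀ i, π i η' = η i := fun i => rfl
  let L : (H →L[ℂ] H) →ₗ[ℂ] K :=
    { toFun := fun a => D a η'
      map_add' := fun a b => hext _ _ fun i => by simp [hπD]
      map_smul' := fun c a => hext _ _ fun i => by simp [hπD] }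
  let E : Submodule ℂ K := (A.toSubalgebra.toSubmodule.map L).topologicalClosure
  have : CompleteSpace E := (Submodule.isClosed_topologicalClosure _).completeSpace_coe
  have hmem : ∀ a ∈ A, D a η' ∈ E := fun a ha =>
    Submodule.le_topologicalClosure _ ⟨a, ha, rfl⟩
  have hDD : ∀ a b ξ, D a (D b ξ) = D (a * b) ξ := fun a b ξ =>
    hext _ _ fun i => by simp [hπD]
  have hinv : ∀ a ∈ A, E ≤ E.comap (D a : K →ₗ[ℂ] K) := by
    intro a ha
    refine Submodule.topologicalClosure_minimal _ ?_ ?_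
    · rintro _ ⟨b, hb, rfl⟩
      change D a (D b η') ∈ E
      rw [hDD]
      exact hmem _ (mul_mem ha hb)
    · exact (Submodule.isClosed_topologicalClosure _).preimage (D a).continuous
  have hadj : ∀ T, star (D T) = D (star T) := by
    intro T
    rw [ContinuousLinearMap.star_eq_adjoint, eq_comm, ContinuousLinearMap.eq_adjoint_iff]
    intro ξ ζ
    rw [PiLp.inner_apply, PiLp.inner_apply]
    refine Finset.sum_congr rfl fun i _ => ?_
    change inner ℂ (star T (π i ξ)) (π i ζ) = inner ℂ (π i ξ) (T (π i ζ))
    rw [ContinuousLinearMap.star_eq_adjoint, ContinuousLinearMap.adjoint_inner_left]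
  let P := E.starProjection
  have hP : IsStarProjection P := isStarProjection_starProjection
  have hrange : P.range = E := Submodule.range_starProjection E
  have hleft : ∀ a ∈ A, P * (D a * P) = D a * P := by
    intro a ha
    ext1 ξ
    exact Submodule.starProjection_eq_self_iff.2
      (hinv a ha (Submodule.starProjection_apply_mem E ξ))
  have hcomm : ∀ a ∈ A, P * D a = D a * P := by
    intro a ha
    have h1 := congrArg star (hleft _ (star_mem ha))
    simp only [star_mul, hadj, star_star, hP.isSelfAdjoint.star_eq] at h1
    rw [← hleft a ha, ← mul_assoc, h1]
  have hentry : ∀ i j, (π i ∘L P ∘L κ j) ∈ Set.centralizer (A : Set (H →L[ℂ] H)) := by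
    intro i j a ha
    ext1 ξ
    change a (π i (P (κ j ξ))) = π i (P (κ j (a ξ)))
    rw [← hDκ, ← hπD]
    exact congrArg (π i) (DFunLike.congr_fun (hcomm a ha) _).symm
  have hPy : P (D y η') = D y (P η') := by
    refine hext _ _ fun i => ?_
    rw [hsum (D y η'), hπD]
    conv_rhs => rw [hsum η']
    simp only [map_sum]
    refine Finset.sum_congr rfl fun j _ => ?_
    exact DFunLike.congr_fun (hy _ (hentry i j)) (η j)
  have h1 : η' ∈ E := by
    have := hmem 1 (one_mem A)
    rwa [show D 1 η' = η' from hext _ _ fun i => by simp [hπD]] at this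
  have hyE : D y η' ∈ E := by
    rw [← Submodule.starProjection_eq_self_iff]
    change P _ = _
    rw [hPy, show P η' = η' from Submodule.starProjection_eq_self_iff.2 h1]
  obtain ⟨_, ⟨a, ha, rfl⟩, hlt⟩ := Metric.mem_closure_iff.1 hyE ε hε
  refine ⟨a, ha, fun i => ?_⟩
  rw [dist_comm, dist_eq_norm] at hlt
  exact (PiLp.norm_apply_le (D a η' - D y η') i).trans_lt hlt

theorem Submodule.mem_closure_of_forall_inner_eq_zero {K : Type*} [NormedAddCommGroup K]
    [InnerProductSpace ℝ K] [CompleteSpace K] (V : Submodule ℝ K) {w : K}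
    (hw : ∀ ζ : K, (∀ v ∈ V, inner ℝ ζ v = 0) → inner ℝ ζ w = 0) : w ∈ closure (V : Set K) := by
  rw [← Submodule.topologicalClosure_coe, ← Submodule.orthogonal_orthogonal_eq_closure]
  exact (Submodule.mem_orthogonal _ _).2 fun ζ hζ =>
    hw ζ ((Submodule.mem_orthogonal' _ _).1 hζ)

/-- Separation of points from real-linear subsets of a complex Hilbert space. -/
theorem mem_closure_of_forall_re_inner_eq_zero {K : Type*} [NormedAddCommGroup K]
    [InnerProductSpace ℂ K] [CompleteSpace K] {s : Set K} (h0 : 0 ∈ s)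
    (hadd : ∀ a ∈ s, ∀ b ∈ s, a + b ∈ s) (hsmul : ∀ (c : ℝ), ∀ a ∈ s, (c : ℂ) • a ∈ s) {w : K}
    (hw : ∀ ζ : K, (∀ v ∈ s, (inner ℂ ζ v).re = 0) → (inner ℂ ζ w).re = 0) :
    w ∈ closure s :=
  let : InnerProductSpace ℝ K := InnerProductSpace.rclikeToReal ℂ K
  Submodule.mem_closure_of_forall_inner_eq_zero (K := K)
    { carrier := s
      add_mem' := fun ha hb => hadd _ ha _ hb
      zero_mem' := h0
      smul_mem' := fun c a ha => hsmul c a ha } hw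

/-- Self-adjoint operators in the bicommutant are approximated by self-adjoint elements. -/
theorem exists_isSelfAdjoint_mem_norm_sub_lt (A : StarSubalgebra ℂ (H →L[ℂ] H))
    {y : H →L[ℂ] H} (hy : y ∈ Set.centralizer (Set.centralizer (A : Set (H →L[ℂ] H))))
    (hys : IsSelfAdjoint y) {ι : Type*} [Finite ι] (η : ι → H) {ε : ℝ} (hε : 0 < ε) :
    ∃ a ∈ A, IsSelfAdjoint a ∧ ∀ i, ‖a (η i) - y (η i)‖ < ε := by
  classical
  have := Fintype.ofFinite ι
  let K := PiLp 2 (fun _ : ι => H)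
  let ev : (H →L[ℂ] H) → K := fun a => WithLp.toLp 2 fun i => a (η i)
  have hsub : ev y ∈ closure (ev '' {a : H →L[ℂ] H | a ∈ A ∧ IsSelfAdjoint a}) := by
    refine mem_closure_of_forall_re_inner_eq_zero ?_ ?_ ?_ ?_
    · exact ⟨0, ⟨zero_mem A, .zero _⟩, rfl⟩
    · rintro _ ⟨a, ha, rfl⟩ _ ⟨b, hb, rfl⟩
      exact ⟨a + b, ⟨add_mem ha.1 hb.1, ha.2.add hb.2⟩, rfl⟩
    · rintro c _ ⟨a, ha, rfl⟩
      exact ⟨(c : ℂ) • a, ⟨A.smul_mem ha.1 _, IsSelfAdjoint.smul (Complex.conj_ofReal c) ha.2⟩, rfl⟩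
    intro ζ hζ
    have hinner : ∀ a : H →L[ℂ] H,
        (inner ℂ ζ (ev a)).re = (∑ i, inner ℂ (ζ i) (a (η i))).re := by
      intro a
      rw [PiLp.inner_apply]
    have hsa : ∀ a ∈ A, (∑ i, inner ℂ (ζ i) (a (η i))).re +
        (∑ i, inner ℂ (a (ζ i)) (η i)).re = 0 := by
      intro a ha
      have h0 : (inner ℂ ζ (ev (a + star a))).re = 0 :=
        hζ _ ⟨_, ⟨add_mem ha (star_mem ha), IsSelfAdjoint.add_star_self a⟩, rfl⟩
      rw [hinner] at h0
      simpa only [add_apply, inner_add_right, Finset.sum_add_distrib,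
        Complex.add_re, ContinuousLinearMap.star_eq_adjoint,
        ContinuousLinearMap.adjoint_inner_right] using h0
    have hysum : (∑ i, inner ℂ (y (ζ i)) (η i)).re = (∑ i, inner ℂ (ζ i) (y (η i))).re := by
      congr 2
      ext i
      rw [← ContinuousLinearMap.adjoint_inner_right, ← ContinuousLinearMap.star_eq_adjoint,
        hys.star_eq]
    rw [hinner]
    have key : ∀ δ > 0, |2 * (∑ i, inner ℂ (ζ i) (y (η i))).re| ≤
        δ * ∑ i, (‖ζ i‖ + ‖η i‖) := by
      intro δ hδ
      obtain ⟨a, ha, hlt⟩ := exists_mem_norm_sub_lt_of_mem_bicommutant A hy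
        (Sum.elim η fun i => ζ i) hδ
      have h3 : 2 * (∑ i, inner ℂ (ζ i) (y (η i))).re =
          (∑ i, (inner ℂ (ζ i) ((y - a) (η i)) + inner ℂ ((y - a) (ζ i)) (η i))).re := by
        simp only [sub_apply, inner_sub_left, inner_sub_right,
          Finset.sum_add_distrib, Finset.sum_sub_distrib, Complex.add_re, Complex.sub_re]
        linarith [hsa a ha, hysum]
      rw [h3, Finset.mul_sum]
      refine (Complex.abs_re_le_norm _).trans ((norm_sum_le _ _).trans ?_)
      refine Finset.sum_le_sum fun i _ => (norm_add_le _ _).trans ?_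
      have e1 := (hlt (.inl i)).le
      have e2 := (hlt (.inr i)).le
      simp only [Sum.elim_inl, Sum.elim_inr] at e1 e2
      rw [norm_sub_rev] at e1 e2
      have f1 := norm_inner_le_norm (𝕜 := ℂ) (ζ i) ((y - a) (η i))
      have f2 := norm_inner_le_norm (𝕜 := ℂ) ((y - a) (ζ i)) (η i)
      simp only [sub_apply] at f1 f2 ⊢
      nlinarith [norm_nonneg (ζ i), norm_nonneg (η i),
        mul_le_mul_of_nonneg_left e1 (norm_nonneg (ζ i)),
        mul_le_mul_of_nonneg_right e2 (norm_nonneg (η i))]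
    have hlim : Tendsto (fun δ : ℝ => δ * ∑ i, (‖ζ i‖ + ‖η i‖)) (𝓝[>] 0) (𝓝 0) := by
      have : Tendsto (fun δ : ℝ => δ * ∑ i, (‖ζ i‖ + ‖η i‖)) (𝓝 0)
          (𝓝 (0 * ∑ i, (‖ζ i‖ + ‖η i‖))) := (continuous_mul_const _).tendsto 0
      rw [zero_mul] at this
      exact this.mono_left nhdsWithin_le_nhds
    have := ge_of_tendsto hlim (eventually_nhdsWithin_of_forall key)
    have := abs_nonpos_iff.1 this
    linarith
  obtain ⟨_, ⟨a, ha, rfl⟩, hlt⟩ := Metric.mem_closure_iff.1 hsub ε hε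
  refine ⟨a, ha.1, ha.2, fun i => ?_⟩
  rw [dist_comm, dist_eq_norm] at hlt
  exact (PiLp.norm_apply_le (ev a - ev y) i).trans_lt hlt

end Density

section Normal

variable {H : Type*} [NormedAddCommGroup H] [InnerProductSpace ℂ H] [CompleteSpace H]

/-- The closed subspace spanned by the orbits of the vectors in `S` under the operators in `C`. -/
def orbitSpan (C : Set (H →L[ℂ] H)) (S : Set H) : Submodule ℂ H :=
  (Submodule.span ℂ {ζ | ∃ T ∈ C, ∃ ξ ∈ S, T ξ = ζ}).topologicalClosure

instance orbitSpan.instCompleteSpace (C : Set (H →L[ℂ] H)) (S : Set H) :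
    CompleteSpace (orbitSpan C S) :=
  (Submodule.isClosed_topologicalClosure _).completeSpace_coe

omit [CompleteSpace H] in
theorem orbitSpan_mono (C : Set (H →L[ℂ] H)) {S T : Set H} (h : S ⊆ T) :
    orbitSpan C S ≤ orbitSpan C T :=
  Submodule.topologicalClosure_mono <| Submodule.span_mono fun _ ⟨R, hR, ξ, hξ, e⟩ =>
    ⟨R, hR, ξ, h hξ, e⟩

theorem starProjection_orbitSpan_mem_bicommutant (A : StarSubalgebra ℂ (H →L[ℂ] H)) (S : Set H) :
    (orbitSpan (Set.centralizer (A : Set (H →L[ℂ] H))) S).starProjection ∈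
      Set.centralizer (Set.centralizer (A : Set (H →L[ℂ] H))) := by
  set C := Set.centralizer (A : Set (H →L[ℂ] H)) with hC
  set P := (orbitSpan C S).starProjection with hPdef
  have hP : IsStarProjection P := isStarProjection_starProjection
  have hstar : ∀ T ∈ C, star T ∈ C := fun T hT => by
    intro a ha
    have := congrArg star (hT (star a) (star_mem ha))
    simpa using this.symm
  have hinv : ∀ T ∈ C, orbitSpan C S ≤ (orbitSpan C S).comap (T : H →ₗ[ℂ] H) := by
    intro T hT
    refine Submodule.topologicalClosure_minimal _ ?_
      ((Submodule.isClosed_topologicalClosure _).preimage T.continuous)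
    rw [Submodule.span_le]
    rintro _ ⟨R, hR, ξ, hξ, rfl⟩
    exact Submodule.le_topologicalClosure _
      (Submodule.subset_span ⟨T * R, Set.mul_mem_centralizer hT hR, ξ, hξ, rfl⟩)
  have hleft : ∀ T ∈ C, P * (T * P) = T * P := by
    intro T hT
    ext1 ξ
    exact Submodule.starProjection_eq_self_iff.2
      (hinv T hT (Submodule.starProjection_apply_mem _ ξ))
  intro T hT
  have h1 := congrArg star (hleft _ (hstar T hT))
  simp only [star_mul, star_star, hP.isSelfAdjoint.star_eq] at h1
  rw [← hleft T hT, ← mul_assoc, h1]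

/-- If a star subalgebra has a bicommutant carrying a faithful positive functional, then its
commutant has a countable cyclic family of vectors. -/
theorem exists_countable_orbitSpan_eq_top (A : StarSubalgebra ℂ (H →L[ℂ] H))
    (ω : (H →L[ℂ] H) →ₗ[ℂ] ℂ)
    (hpos : ∀ m ∈ Set.centralizer (Set.centralizer (A : Set (H →L[ℂ] H))), 0 ≤ ω (star m * m))
    (hfaith : ∀ m ∈ Set.centralizer (Set.centralizer (A : Set (H →L[ℂ] H))),
      ω (star m * m) = 0 → m = 0) :
    ∃ S : Set H, S.Countable ∧ orbitSpan (Set.centralizer (A : Set (H →L[ℂ] H))) S = ⊤ := by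
  set C := Set.centralizer (A : Set (H →L[ℂ] H)) with hC
  let e : Set H → H →L[ℂ] H := fun S => (orbitSpan C S).starProjection
  have hsub : ∀ P Q : H →L[ℂ] H, IsStarProjection P → IsStarProjection Q →
      P ∈ Set.centralizer C → Q ∈ Set.centralizer C → Q * P = P →
      (ω P).re ≤ (ω Q).re ∧ ((ω P).re = (ω Q).re → P = Q) := by
    intro P Q hP hQ hPN hQN hQP
    have hPQ : P * Q = P := by
      have := congrArg star hQP
      rwa [star_mul, hP.isSelfAdjoint.star_eq, hQ.isSelfAdjoint.star_eq] at this
    have hN : Q - P ∈ Set.centralizer C := by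
      have := Set.add_mem_centralizer hQN (Set.neg_mem_centralizer hPN)
      rwa [← sub_eq_add_neg] at this
    have hsq : star (Q - P) * (Q - P) = Q - P := by
      rw [star_sub, hP.isSelfAdjoint.star_eq, hQ.isSelfAdjoint.star_eq, sub_mul, mul_sub, mul_sub,
        hPQ, hQP, hP.isIdempotentElem.eq, hQ.isIdempotentElem.eq]
      abel
    have h1 := hpos _ hN
    have h2 := hfaith _ hN
    rw [hsq, map_sub] at h1 h2
    rw [Complex.le_def] at h1
    simp only [Complex.zero_re, Complex.sub_re, Complex.zero_im] at h1
    refine ⟨by linarith [h1.1], fun h => (sub_eq_zero.1 (h2 ?_)).symm⟩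
    apply Complex.ext
    · simp [h]
    · exact h1.2.symm
  have heP : ∀ S, IsStarProjection (e S) := fun S => isStarProjection_starProjection
  have heN : ∀ S, e S ∈ Set.centralizer C := starProjection_orbitSpan_mem_bicommutant A
  have hmul : ∀ S T : Set H, S ⊆ T → e T * e S = e S := by
    intro S T hST
    ext1 ξ
    exact Submodule.starProjection_eq_self_iff.2
      (orbitSpan_mono C hST (Submodule.starProjection_apply_mem _ ξ))
  have hmono : ∀ S T : Set H, S ⊆ T → (ω (e S)).re ≤ (ω (e T)).re := fun S T h =>
    (hsub _ _ (heP S) (heP T) (heN S) (heN T) (hmul S T h)).1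
  let F : Set ℝ := {r | ∃ S : Set H, S.Countable ∧ (ω (e S)).re = r}
  have hFb : BddAbove F := by
    refine ⟨(ω 1).re, ?_⟩
    rintro _ ⟨S, -, rfl⟩
    exact (hsub _ 1 (heP S) (.one _) (heN S) (Set.one_mem_centralizer) (one_mul _)).1
  have hFn : F.Nonempty := ⟨_, ∅, Set.countable_empty, rfl⟩
  obtain ⟨r, -, hr, hrF⟩ := exists_seq_tendsto_sSup hFn hFb
  choose S hS hSr using hrF
  let U : Set H := ⋃ n, S n
  have hU : U.Countable := Set.countable_iUnion hS
  have hsup : sSup F ≤ (ω (e U)).re :=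
    le_of_tendsto' hr fun n => by
      rw [← hSr]
      exact hmono _ _ (Set.subset_iUnion S n)
  refine ⟨U, hU, ?_⟩
  rw [eq_top_iff]
  intro ξ _
  have hins : (insert ξ U).Countable := hU.insert ξ
  have hle : (ω (e (insert ξ U))).re ≤ (ω (e U)).re := (le_csSup hFb ⟨_, hins, rfl⟩).trans hsup
  have hsubset := Set.subset_insert ξ U
  have heq := (hsub _ _ (heP _) (heP _) (heN _) (heN _) (hmul U _ hsubset)).2
    (le_antisymm (hmono _ _ hsubset) hle)
  have hmem : ξ ∈ orbitSpan C (insert ξ U) := Submodule.le_topologicalClosure _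
    (Submodule.subset_span ⟨1, Set.one_mem_centralizer, ξ, Set.mem_insert _ _, rfl⟩)
  rw [← Submodule.starProjection_eq_self_iff] at hmem ⊢
  exact (DFunLike.congr_fun heq ξ).trans hmem

/-- Sequential normality on bounded sequences of a set `M` of operators. -/
def IsSeqNormalOn (M : Set (H →L[ℂ] H)) (φ : (H →L[ℂ] H) → ℂ) : Prop :=
  ∀ (w : H →L[ℂ] H) (R : ℕ → H →L[ℂ] H) (c : ℝ),
    w ∈ M → (∀ k, R k ∈ M) → (∀ k, ‖R k‖ ≤ c) →
    (∀ ξ : H, Tendsto (fun k => R k ξ) atTop (𝓝 (w ξ))) →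
    Tendsto (fun k => φ (R k)) atTop (𝓝 (φ w))

omit [CompleteSpace H] in
theorem IsSeqNormalOn.mono {M N : Set (H →L[ℂ] H)} {φ : (H →L[ℂ] H) → ℂ}
    (h : IsSeqNormalOn M φ) (hN : N ⊆ M) : IsSeqNormalOn N φ :=
  fun w R c hw hR => h w R c (hN hw) fun k => hN (hR k)

omit [CompleteSpace H] in
theorem IsSeqNormalOn.eq_zero_of_mem_closure {M : Set (H →L[ℂ] H)} {φ : (H →L[ℂ] H) → ℂ}
    (hφ : IsSeqNormalOn M φ) {s : Set (H →L[ℂ] H)} (hs : s ⊆ M) (h0 : ∀ a ∈ s, φ a = 0)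
    {w : H →L[ℂ] H} (hw : w ∈ M) (hws : w ∈ closure s) : φ w = 0 := by
  obtain ⟨R, hR, hlim⟩ := mem_closure_iff_seq_limit.1 hws
  obtain ⟨c, hc⟩ := hlim.norm.bddAbove_range
  have h := hφ w R c hw (fun k => hs (hR k)) (fun k => hc ⟨k, rfl⟩)
    fun ξ => ((ContinuousLinearMap.apply ℂ H ξ).continuous.tendsto w).comp hlim
  simp only [h0 _ (hR _)] at h
  exact tendsto_nhds_unique h tendsto_const_nhds

theorem IsSelfAdjoint.isUnit_one_add_I_smul {y : H →L[ℂ] H} (hy : IsSelfAdjoint y) :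
    IsUnit (1 + Complex.I • y) := by
  have h : Complex.I ∉ spectrum ℂ y := fun h => by
    have := congrArg Complex.im (hy.mem_spectrum_eq_re h)
    simp at this
  rw [spectrum.notMem_iff] at h
  have h2 := h.smul (Units.mk0 (-Complex.I) (by simp))
  convert h2 using 1
  rw [Units.smul_mk0, smul_sub, Algebra.algebraMap_eq_smul_one, smul_smul]
  simp

theorem IsSelfAdjoint.norm_le_norm_one_add_I_smul_apply {y : H →L[ℂ] H} (hy : IsSelfAdjoint y)
    (ξ : H) : ‖ξ‖ ≤ ‖(1 + Complex.I • y) ξ‖ := by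
  have h1 : (inner ℂ ξ (y ξ)).im = 0 := by
    have h := hy.isSymmetric ξ ξ
    have h2 := inner_conj_symm (𝕜 := ℂ) ξ (y ξ)
    simp only [ContinuousLinearMap.coe_coe] at h
    rw [h] at h2
    exact Complex.conj_eq_iff_im.1 h2
  have h2 : ‖(1 + Complex.I • y) ξ‖ ^ 2 = ‖ξ‖ ^ 2 + ‖y ξ‖ ^ 2 := by
    simp only [add_apply, one_apply_eq_self, smul_apply]
    rw [@norm_add_sq ℂ, inner_smul_right, norm_smul]
    simp [h1]
  exact le_of_sq_le_sq (by rw [h2]; nlinarith [sq_nonneg ‖y ξ‖]) (norm_nonneg _)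

theorem norm_ringInverse_one_add_I_smul_le {y : H →L[ℂ] H} (hy : IsSelfAdjoint y) :
    ‖Ring.inverse (1 + Complex.I • y)‖ ≤ 1 := by
  refine ContinuousLinearMap.opNorm_le_bound _ zero_le_one fun ξ => ?_
  have h := hy.norm_le_norm_one_add_I_smul_apply (Ring.inverse (1 + Complex.I • y) ξ)
  have h1 : (1 + Complex.I • y) (Ring.inverse (1 + Complex.I • y) ξ) = ξ :=
    DFunLike.congr_fun (Ring.mul_inverse_cancel _ hy.isUnit_one_add_I_smul) ξ
  rwa [h1, ← one_mul ‖ξ‖] at h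

theorem ringInverse_one_add_I_smul_mem_bicommutant {s : Set (H →L[ℂ] H)} {y : H →L[ℂ] H}
    (hy : IsSelfAdjoint y) (hys : y ∈ Set.centralizer s) :
    Ring.inverse (1 + Complex.I • y) ∈ Set.centralizer s := by
  intro T hT
  have h : Commute T (1 + Complex.I • y) :=
    (Commute.one_right T).add_right (Commute.smul_right (hys T hT) _)
  obtain ⟨u, hu⟩ := hy.isUnit_one_add_I_smul
  rw [← hu] at h ⊢
  rw [Ring.inverse_unit]
  exact h.units_inv_right

theorem ringInverse_one_add_I_smul_mem_closure (A : StarSubalgebra ℂ (H →L[ℂ] H))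
    {y : H →L[ℂ] H} (hy : IsSelfAdjoint y) (hyA : y ∈ A) :
    Ring.inverse (1 + Complex.I • y) ∈ closure (A : Set (H →L[ℂ] H)) := by
  have : IsClosed (A.topologicalClosure : Set (H →L[ℂ] H)) := A.isClosed_topologicalClosure
  have hmem : 1 + Complex.I • y ∈ A.topologicalClosure :=
    A.le_topologicalClosure (add_mem (one_mem A) (A.smul_mem hyA _))
  obtain ⟨u, hu⟩ := (StarSubalgebra.coe_isUnit A.topologicalClosure
    (a := ⟨_, hmem⟩)).1 hy.isUnit_one_add_I_smul
  have h1 : (1 + Complex.I • y) * ((u⁻¹ : A.topologicalClosureˣ) : A.topologicalClosure) = 1 := by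
    have := congrArg Subtype.val u.mul_inv
    rwa [hu] at this
  have h2 : Ring.inverse (1 + Complex.I • y) =
      ((u⁻¹ : A.topologicalClosureˣ) : A.topologicalClosure) :=
    left_inv_eq_right_inv (Ring.inverse_mul_cancel _ hy.isUnit_one_add_I_smul) h1
  rw [h2]
  exact Subtype.property _

/-- Resolvents of self-adjoint elements of the bicommutant are strong limits of sequences of
contractions from the norm closure of the algebra. -/
theorem exists_seq_tendsto_ringInverse (A : StarSubalgebra ℂ (H →L[ℂ] H)) {S : Set H}
    (hS : S.Countable) (hSt : orbitSpan (Set.centralizer (A : Set (H →L[ℂ] H))) S = ⊤)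
    {y : H →L[ℂ] H} (hy : y ∈ Set.centralizer (Set.centralizer (A : Set (H →L[ℂ] H))))
    (hys : IsSelfAdjoint y) :
    ∃ b : ℕ → H →L[ℂ] H, (∀ n, b n ∈ A) ∧ (∀ n, IsSelfAdjoint (b n)) ∧
      ∀ ξ, Tendsto (fun n => Ring.inverse (1 + Complex.I • b n) ξ) atTop
        (𝓝 (Ring.inverse (1 + Complex.I • y) ξ)) := by
  set C := Set.centralizer (A : Set (H →L[ℂ] H)) with hC
  obtain ⟨s, hs⟩ : ∃ s : ℕ → H, S ⊆ Set.range s := by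
    obtain rfl | hne := S.eq_empty_or_nonempty
    · exact ⟨0, Set.empty_subset _⟩
    · obtain ⟨s, rfl⟩ := hS.exists_eq_range hne
      exact ⟨s, subset_rfl⟩
  let R := Ring.inverse (1 + Complex.I • y)
  have hex : ∀ n : ℕ, ∃ a ∈ A, IsSelfAdjoint a ∧
      ∀ i : Fin (n + 1), ‖a (R (s i)) - y (R (s i))‖ < 1 / ((n : ℝ) + 1) := fun n =>
    exists_isSelfAdjoint_mem_norm_sub_lt A hy hys (fun i : Fin (n + 1) => R (s i))
      Nat.one_div_pos_of_nat
  choose b hbA hbs hb using hex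
  refine ⟨b, hbA, hbs, ?_⟩
  let Rb : ℕ → H →L[ℂ] H := fun n => Ring.inverse (1 + Complex.I • b n)
  have hAN : (A : Set (H →L[ℂ] H)) ⊆ Set.centralizer C := Set.subset_centralizer_centralizer
  have hRbN : ∀ n, Rb n ∈ Set.centralizer C := fun n =>
    ringInverse_one_add_I_smul_mem_bicommutant (hbs n) (hAN (hbA n))
  have hRN : R ∈ Set.centralizer C := ringInverse_one_add_I_smul_mem_bicommutant hys hy
  have hdiff : ∀ n ξ, ‖Rb n ξ - R ξ‖ ≤ ‖b n (R ξ) - y (R ξ)‖ := by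
    intro n ξ
    have h1 : Rb n - R = Rb n * ((Complex.I • (y - b n)) * R) := by
      have e1 : Rb n * (1 + Complex.I • b n) = 1 :=
        Ring.inverse_mul_cancel _ (hbs n).isUnit_one_add_I_smul
      have e2 : (1 + Complex.I • y) * R = 1 :=
        Ring.mul_inverse_cancel _ hys.isUnit_one_add_I_smul
      calc Rb n - R = Rb n * ((1 + Complex.I • y) * R) - (Rb n * (1 + Complex.I • b n)) * R := by
            rw [e1, e2, mul_one, one_mul]
        _ = _ := by
            rw [mul_assoc, ← mul_sub, ← sub_mul, smul_sub]
            congr 2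
            abel
    rw [← sub_apply, h1]
    refine (ContinuousLinearMap.le_of_opNorm_le _
      (norm_ringInverse_one_add_I_smul_le (hbs n)) _).trans ?_
    simp [norm_smul, norm_sub_rev]
  have hs_lim : ∀ i, Tendsto (fun n => Rb n (s i)) atTop (𝓝 (R (s i))) := by
    intro i
    rw [tendsto_iff_norm_sub_tendsto_zero]
    refine squeeze_zero' (.of_forall fun n => norm_nonneg _) ?_
      (tendsto_one_div_add_atTop_nhds_zero_nat (𝕜 := ℝ))
    filter_upwards [eventually_ge_atTop i] with n hn
    exact (hdiff n _).trans (hb n ⟨i, by lia⟩).le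
  let V : Submodule ℂ H :=
    { carrier := {ξ | Tendsto (fun n => Rb n ξ) atTop (𝓝 (R ξ))}
      add_mem' := fun {ξ ζ} h1 h2 => by simpa using! h1.add h2
      zero_mem' := by simp
      smul_mem' := fun c ξ h => by simpa using! h.const_smul c }
  have hVc : IsClosed (V : Set H) := by
    have hequi : Equicontinuous (fun n ξ => Rb n ξ) :=
      (LipschitzWith.uniformEquicontinuous _ 1 fun n =>
        (Rb n).lipschitzWith_of_opNorm_le
          (norm_ringInverse_one_add_I_smul_le (hbs n))).equicontinuous
    exact hequi.isClosed_setOfPred_tendsto R.continuous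
  have hVtop : (⊤ : Submodule ℂ H) ≤ V := by
    rw [← hSt]
    refine Submodule.topologicalClosure_minimal _ ?_ hVc
    rw [Submodule.span_le]
    rintro _ ⟨T, hT, ξ, hξ, rfl⟩
    obtain ⟨i, rfl⟩ := hs hξ
    have h := (T.continuous.tendsto _).comp (hs_lim i)
    have e1 : ∀ n, T (Rb n (s i)) = Rb n (T (s i)) := fun n =>
      DFunLike.congr_fun (hRbN n T hT) _
    have e2 : T (R (s i)) = R (T (s i)) := DFunLike.congr_fun (hRN T hT) _
    rw [e2] at h
    exact h.congr e1
  exact fun ξ => hVtop (Submodule.mem_top (x := ξ))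

/-- Uniqueness of normal extensions: a sequentially normal functional on an algebra of operators
carrying a faithful positive functional vanishes on the bicommutant of any star subalgebra on
which it vanishes. -/
theorem IsSeqNormalOn.eq_zero_of_mem_bicommutant (A : StarSubalgebra ℂ (H →L[ℂ] H))
    (ω φ : (H →L[ℂ] H) →ₗ[ℂ] ℂ)
    (hpos : ∀ m ∈ Set.centralizer (Set.centralizer (A : Set (H →L[ℂ] H))), 0 ≤ ω (star m * m))
    (hfaith : ∀ m ∈ Set.centralizer (Set.centralizer (A : Set (H →L[ℂ] H))),
      ω (star m * m) = 0 → m = 0)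
    (hφ : IsSeqNormalOn (Set.centralizer (Set.centralizer (A : Set (H →L[ℂ] H)))) φ)
    (h0 : ∀ a ∈ A, φ a = 0) {x : H →L[ℂ] H}
    (hx : x ∈ Set.centralizer (Set.centralizer (A : Set (H →L[ℂ] H)))) : φ x = 0 := by
  obtain ⟨S, hS, hSt⟩ := exists_countable_orbitSpan_eq_top A ω hpos hfaith
  set C := Set.centralizer (A : Set (H →L[ℂ] H)) with hC
  have hAN : (A : Set (H →L[ℂ] H)) ⊆ Set.centralizer C := Set.subset_centralizer_centralizer
  have hsmul : ∀ (c : ℂ) (y : H →L[ℂ] H), y ∈ Set.centralizer C → c • y ∈ Set.centralizer C :=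
    fun c y hy T hT => Commute.smul_right (hy T hT) c
  have hres : ∀ y ∈ Set.centralizer C, IsSelfAdjoint y →
      φ (Ring.inverse (1 + Complex.I • y)) = 0 := by
    intro y hy hys
    obtain ⟨b, hbA, hbs, hlim⟩ := exists_seq_tendsto_ringInverse A hS hSt hy hys
    have hb : ∀ n, Ring.inverse (1 + Complex.I • b n) ∈ Set.centralizer C := fun n =>
      ringInverse_one_add_I_smul_mem_bicommutant (hbs n) (hAN (hbA n))
    have h := hφ _ _ 1 (ringInverse_one_add_I_smul_mem_bicommutant hys hy) hb
      (fun n => norm_ringInverse_one_add_I_smul_le (hbs n)) hlim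
    have hz : ∀ n, φ (Ring.inverse (1 + Complex.I • b n)) = 0 := fun n =>
      hφ.eq_zero_of_mem_closure hAN h0 (hb n)
        (ringInverse_one_add_I_smul_mem_closure A (hbs n) (hbA n))
    simp only [hz] at h
    exact tendsto_nhds_unique h tendsto_const_nhds
  have hsa : ∀ y ∈ Set.centralizer C, IsSelfAdjoint y → φ y = 0 := by
    intro y hy hys
    let t : ℕ → ℂ := fun n => ((1 / ((n : ℝ) + 1) : ℝ) : ℂ)
    have ht0 : ∀ n, t n ≠ 0 := fun n =>
      Complex.ofReal_ne_zero.2 (Nat.one_div_pos_of_nat).ne'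
    have htN : ∀ n, t n • y ∈ Set.centralizer C := fun n => hsmul _ _ hy
    have hts : ∀ n, IsSelfAdjoint (t n • y) := fun n =>
      IsSelfAdjoint.smul (Complex.conj_ofReal _) hys
    let R : ℕ → H →L[ℂ] H := fun n => Ring.inverse (1 + Complex.I • t n • y)
    have hRN : ∀ n, R n ∈ Set.centralizer C := fun n =>
      ringInverse_one_add_I_smul_mem_bicommutant (hts n) (htN n)
    have hR : ∀ n, R n = 1 - Complex.I • t n • (y * R n) := by
      intro n
      have := Ring.mul_inverse_cancel _ (hts n).isUnit_one_add_I_smul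
      rw [add_mul, one_mul, smul_mul_assoc, smul_mul_assoc] at this
      exact eq_sub_of_add_eq this
    have hyR : ∀ n, φ (y * R n) = 0 := by
      intro n
      have h1 := congrArg φ (hR n)
      rw [hres _ (htN n) (hts n), map_sub, h0 1 (one_mem A), map_smul, map_smul, zero_sub,
        zero_eq_neg, smul_eq_zero, smul_eq_zero] at h1
      simpa [ht0 n] using h1
    have hbound : ∀ n, ‖y * R n‖ ≤ ‖y‖ := fun n =>
      (norm_mul_le _ _).trans (mul_le_of_le_one_right (norm_nonneg _)
        (norm_ringInverse_one_add_I_smul_le (hts n)))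
    have hRlim : Tendsto R atTop (𝓝 1) := by
      rw [tendsto_iff_norm_sub_tendsto_zero]
      have hlim : Tendsto (fun n : ℕ => 1 / ((n : ℝ) + 1) * ‖y‖) atTop (𝓝 (0 * ‖y‖)) :=
        (tendsto_one_div_add_atTop_nhds_zero_nat (𝕜 := ℝ)).mul_const _
      rw [zero_mul] at hlim
      refine squeeze_zero (fun n => norm_nonneg _) (fun n => ?_) hlim
      have e : R n - 1 = -(Complex.I • t n • (y * R n)) := by
        nth_rewrite 1 [hR n]
        abel
      have hpos : 0 < 1 / ((n : ℝ) + 1) := Nat.one_div_pos_of_nat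
      rw [e, norm_neg, norm_smul, norm_smul, Complex.norm_I, one_mul, Complex.norm_real,
        Real.norm_of_nonneg hpos.le]
      exact mul_le_mul_of_nonneg_left (hbound n) hpos.le
    have hlim : Tendsto (fun n => y * R n) atTop (𝓝 y) := by
      simpa using hRlim.const_mul y
    have h := hφ y (fun n => y * R n) ‖y‖ hy (fun n => Set.mul_mem_centralizer hy (hRN n)) hbound
      fun ξ => ((ContinuousLinearMap.apply ℂ H ξ).continuous.tendsto y).comp hlim
    simp only [hyR] at h
    exact tendsto_nhds_unique h tendsto_const_nhds
  have hstarC : ∀ T ∈ C, star T ∈ C := fun T hT a ha => by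
    have := congrArg star (hT (star a) (star_mem ha))
    simpa using this.symm
  have hstarN : star x ∈ Set.centralizer C := fun T hT => by
    have := congrArg star (hx (star T) (hstarC T hT))
    simpa using this.symm
  have h1 := hsa (x + star x) (Set.add_mem_centralizer hx hstarN) (IsSelfAdjoint.add_star_self x)
  have h2 := hsa (Complex.I • (x - star x))
    (hsmul _ _ (by
      rw [sub_eq_add_neg]
      exact Set.add_mem_centralizer hx (Set.neg_mem_centralizer hstarN))) (by
      simp [isSelfAdjoint_iff, star_smul, ← smul_neg])
  rw [map_add] at h1
  rw [map_smul, smul_eq_zero, map_sub] at h2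
  have h3 := h2.resolve_left Complex.I_ne_zero
  linear_combination (h1 + h3) / 2

end Normal

section AlternatingWords

/-- `x` is a nontrivial alternating product of elements of `S` and of `T`, whose last factor is
taken from `S` if `c = true` and from `T` if `c = false`. -/
def IsAltWord {R : Type*} [Monoid R] (S T : Set R) (c : Bool) (x : R) : Prop :=
  ∃ (n : ℕ) (y : Fin (n + 1) → R) (d : Fin (n + 1) → Bool),
    (∀ i, (d i = true → y i ∈ S) ∧ (d i = false → y i ∈ T)) ∧
    (∀ i : Fin n, d i.castSucc ≠ d i.succ) ∧ d (Fin.last n) = c ∧ (List.ofFn y).prod = x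

theorem FreeOn.eq_zero_of_isAltWord {R Z : Type*} [Monoid R] [Zero Z] {φ : R → Z} {S T : Set R}
    (h : FreeOn φ S T) {c : Bool} {x : R} (hx : IsAltWord S T c x) : φ x = 0 := by
  obtain ⟨n, y, d, h1, h2, -, rfl⟩ := hx
  exact h n y d h1 h2

namespace IsAltWord

variable {R : Type*} [Monoid R] {S T : Set R} {x g : R}

theorem of_mem {c : Bool} (h1 : c = true → g ∈ S) (h2 : c = false → g ∈ T) :
    IsAltWord S T c g :=
  ⟨0, fun _ => g, fun _ => c, fun _ => ⟨h1, h2⟩, fun i => i.elim0, rfl, by simp⟩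

theorem mul_of_mem {c : Bool} (hx : IsAltWord S T (!c) x) (h1 : c = true → g ∈ S)
    (h2 : c = false → g ∈ T) : IsAltWord S T c (x * g) := by
  obtain ⟨n, y, d, hd1, hd2, hlast, rfl⟩ := hx
  refine ⟨n + 1, Fin.snoc y g, Fin.snoc d c, fun i => ?_, fun i => ?_, by simp, ?_⟩
  · induction i using Fin.lastCases with
    | last => simpa using ⟨h1, h2⟩
    | cast i => simpa using hd1 i
  · induction i using Fin.lastCases with
    | last => simp [hlast]
    | cast i =>
      rw [Fin.succ_castSucc, Fin.snoc_castSucc, Fin.snoc_castSucc]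
      exact hd2 i
  · rw [List.ofFn_succ', List.concat_eq_append, List.prod_append]
    simp

theorem left (hg : g ∈ S) : IsAltWord S T true g := of_mem (fun _ => hg) (by simp)

theorem right (hg : g ∈ T) : IsAltWord S T false g := of_mem (by simp) (fun _ => hg)

theorem mul_left (hx : IsAltWord S T false x) (hg : g ∈ S) : IsAltWord S T true (x * g) :=
  mul_of_mem hx (fun _ => hg) (by simp)

theorem mul_right (hx : IsAltWord S T true x) (hg : g ∈ T) : IsAltWord S T false (x * g) :=
  mul_of_mem hx (by simp) (fun _ => hg)

theorem word {a b : R} (ha : a ∈ S) (hb : b ∈ T) (m : ℕ) :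
    IsAltWord S T false ((b * a) ^ m * b) := by
  induction m with
  | zero => simpa using right hb
  | succ m ih =>
    rw [pow_succ, ← mul_assoc]
    exact (ih.mul_left ha).mul_right hb

theorem mul_word {a b : R} (hx : IsAltWord S T true x) (ha : a ∈ S) (hb : b ∈ T) (m : ℕ) :
    IsAltWord S T false (x * ((b * a) ^ m * b)) := by
  induction m with
  | zero => simpa using hx.mul_right hb
  | succ m ih =>
    rw [show x * ((b * a) ^ (m + 1) * b) = x * ((b * a) ^ m * b) * a * b by
      simp only [pow_succ, mul_assoc]]
    exact (ih.mul_left ha).mul_right hb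

end IsAltWord

end AlternatingWords

/-- The algebra generated by two elements is spanned by reduced words, sandwiched between the
spectral idempotents of the first generator. -/
theorem mem_span_of_mem_adjoin_pair {R : Type*} [Ring R] [Algebra ℂ R] {e : Fin 2 → R}
    (hmul : ∀ i j, e i * e j = if i = j then e i else 0) (hone : e 0 + e 1 = 1)
    {a b : R} {κ σ τ : Fin 2 → ℂ} (he : ∀ i, e i = κ i • 1 + σ i • a)
    (ha : a = τ 0 • e 0 + τ 1 • e 1) {s t r : ℂ} (hb : b * b = s • 1 + t • b)
    {x : R} (hx : x ∈ Algebra.adjoin ℂ {e 1, r • 1 + b}) :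
    x ∈ Submodule.span ℂ
      (Set.range e ∪ {z | ∃ i j m, z = e i * ((b * a) ^ m * b) * e j}) := by
  set V := Submodule.span ℂ
    (Set.range e ∪ {z | ∃ i j m, z = e i * ((b * a) ^ m * b) * e j}) with hV
  have hmem1 : ∀ i, e i ∈ V := fun i => Submodule.subset_span (.inl ⟨i, rfl⟩)
  have hmem2 : ∀ i m j, e i * ((b * a) ^ m * b) * e j ∈ V := fun i m j =>
    Submodule.subset_span (.inr ⟨i, j, m, rfl⟩)
  have hmem3 : ∀ m j, ((b * a) ^ m * b) * e j ∈ V := fun m j => by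
    rw [← one_mul ((b * a) ^ m * b), ← hone, add_mul, add_mul]
    exact add_mem (hmem2 0 m j) (hmem2 1 m j)
  have hclosed : ∀ y : R, (∀ i, y * e i ∈ V) →
      (∀ i m j, y * (e i * ((b * a) ^ m * b) * e j) ∈ V) → ∀ z ∈ V, y * z ∈ V := by
    intro y h1 h2
    have : V ≤ V.comap (LinearMap.mulLeft ℂ y) := by
      rw [hV, Submodule.span_le, ← hV]
      rintro _ (⟨i, rfl⟩ | ⟨i, j, m, rfl⟩)
      · exact h1 i
      · exact h2 i m j
    exact this
  have hp : ∀ i, ∀ z ∈ V, e i * z ∈ V := fun i => hclosed _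
    (fun j => by
      rw [hmul]
      split_ifs
      exacts [hmem1 _, zero_mem _])
    (fun j m k => by
      rw [← mul_assoc, ← mul_assoc, hmul]
      split_ifs
      · exact hmem2 _ _ _
      · simp)
  have hamem : ∀ z ∈ V, a * z ∈ V := fun z hz => by
    rw [ha, add_mul, smul_mul_assoc, smul_mul_assoc]
    exact add_mem (V.smul_mem _ (hp 0 z hz)) (V.smul_mem _ (hp 1 z hz))
  have hbw : ∀ m j, b * (((b * a) ^ m * b) * e j) ∈ V := by
    intro m j
    cases m with
    | zero =>
      rw [pow_zero, one_mul, ← mul_assoc, hb, add_mul, smul_mul_assoc, smul_mul_assoc, one_mul]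
      refine add_mem (V.smul_mem _ (hmem1 j)) (V.smul_mem _ ?_)
      simpa using hmem3 0 j
    | succ m =>
      have : b * (((b * a) ^ (m + 1) * b) * e j) =
          s • (a * (((b * a) ^ m * b) * e j)) + t • (((b * a) ^ (m + 1) * b) * e j) := by
        have h1 : b * (((b * a) ^ (m + 1) * b) * e j) =
            (b * b) * (a * (((b * a) ^ m * b) * e j)) := by
          rw [pow_succ']
          simp only [mul_assoc]
        rw [h1, hb, add_mul, smul_mul_assoc, smul_mul_assoc, one_mul, pow_succ']
        simp only [mul_assoc]
      rw [this]
      exact add_mem (V.smul_mem _ (hamem _ (hmem3 m j))) (V.smul_mem _ (hmem3 (m + 1) j))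
  have hbmem : ∀ z ∈ V, b * z ∈ V := hclosed _
    (fun i => by simpa using hmem3 0 i)
    (fun i m j => by
      have : b * (e i * ((b * a) ^ m * b) * e j) =
          κ i • (b * (((b * a) ^ m * b) * e j)) + σ i • (((b * a) ^ (m + 1) * b) * e j) := by
        rw [he i, pow_succ']
        simp only [add_mul, mul_add, smul_mul_assoc, mul_smul_comm, one_mul, mul_assoc]
      rw [this]
      exact add_mem (V.smul_mem _ (hbw m j)) (V.smul_mem _ (hmem3 _ j)))
  have hall : ∀ z ∈ V, x * z ∈ V := by
    induction hx using Algebra.adjoin_induction with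
    | mem y hy =>
      intro z hz
      obtain rfl | rfl := hy
      · exact hp 1 z hz
      · rw [add_mul, smul_mul_assoc, one_mul]
        exact add_mem (V.smul_mem _ hz) (hbmem z hz)
    | algebraMap c =>
      intro z hz
      rw [← Algebra.smul_def]
      exact V.smul_mem c hz
    | add y y' _ _ h h' =>
      intro z hz
      rw [add_mul]
      exact add_mem (h z hz) (h' z hz)
    | mul y y' _ _ h h' =>
      intro z hz
      rw [mul_assoc]
      exact h _ (h' z hz)
  have h1 : (1 : R) ∈ V := hone ▸ add_mem (hmem1 0) (hmem1 1)
  simpa using hall 1 h1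

section FreePair

variable {H : Type*} [NormedAddCommGroup H] [InnerProductSpace ℂ H] [CompleteSpace H]

theorem IsSeqNormalOn.comp_mul_mul {M : VonNeumannAlgebra H} {ω : (H →L[ℂ] H) →ₗ[ℂ] ℂ}
    (hω : IsSeqNormalOn (M : Set (H →L[ℂ] H)) ω) {F G : H →L[ℂ] H} (hF : F ∈ M) (hG : G ∈ M) :
    IsSeqNormalOn (M : Set (H →L[ℂ] H)) (fun n => ω (F * n * G)) := by
  intro w R c hw hR hc hlim
  refine hω _ _ (‖F‖ * c * ‖G‖) (mul_mem (mul_mem hF hw) hG)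
    (fun k => mul_mem (mul_mem hF (hR k)) hG) (fun k => ?_) fun ξ => ?_
  · exact (norm_mul_le _ _).trans <| mul_le_mul_of_nonneg_right
      ((norm_mul_le _ _).trans <| mul_le_mul_of_nonneg_left (hc k) (norm_nonneg _)) (norm_nonneg _)
  · exact (F.continuous.tendsto _).comp (hlim (G ξ))

/-- Two free subalgebras: one spanned by a pair of complementary projections `e 0`, `e 1` and the
other by `1` and the projection `r • 1 + b`, with `a ∈ S` and `b ∈ T` their centered generators. -/
structure IsFreeProjectionPair (M : VonNeumannAlgebra H) (ω : (H →L[ℂ] H) →ₗ[ℂ] ℂ)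
    (S T : Set (H →L[ℂ] H)) (e : Fin 2 → H →L[ℂ] H) (a b : H →L[ℂ] H)
    (κ σ τ : Fin 2 → ℂ) (r s t : ℂ) : Prop where
  nonneg : ∀ m ∈ M, 0 ≤ ω (star m * m)
  faithful : ∀ m ∈ M, ω (star m * m) = 0 → m = 0
  normal : IsSeqNormalOn (M : Set (H →L[ℂ] H)) ω
  free : FreeOn ω S T
  mem_left : a ∈ S
  mem_right : b ∈ T
  mem : ∀ i, e i ∈ M
  isSelfAdjoint : ∀ i, star (e i) = e i
  mul : ∀ i j, e i * e j = if i = j then e i else 0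
  add : e 0 + e 1 = 1
  ne_zero : ∀ i, ω (e i) ≠ 0
  eq_smul : ∀ i, e i = κ i • 1 + σ i • a
  left_eq : a = τ 0 • e 0 + τ 1 • e 1
  right_mul_self : b * b = s • 1 + t • b
  proj_mem : r • 1 + b ∈ M
  star_proj : star (r • 1 + b) = r • 1 + b

/-- `R` is an element of `M` annihilated from the left by reduced words ending in `T`. -/
def IsTailNull (M : VonNeumannAlgebra H) (ω : (H →L[ℂ] H) →ₗ[ℂ] ℂ)
    (S T : Set (H →L[ℂ] H)) (R : H →L[ℂ] H) : Prop :=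
  R ∈ M ∧ ∀ u ∈ M, IsAltWord S T false u → ω (u * R) = 0

namespace IsFreeProjectionPair

variable {M : VonNeumannAlgebra H} {ω : (H →L[ℂ] H) →ₗ[ℂ] ℂ} {S T : Set (H →L[ℂ] H)}
  {e : Fin 2 → H →L[ℂ] H} {a b : H →L[ℂ] H} {κ σ τ : Fin 2 → ℂ} {r s t : ℂ}

theorem left_mem (h : IsFreeProjectionPair M ω S T e a b κ σ τ r s t) : a ∈ M := by
  rw [h.left_eq]
  exact add_mem (M.toStarSubalgebra.smul_mem (h.mem 0) _) (M.toStarSubalgebra.smul_mem (h.mem 1) _)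

theorem right_mem (h : IsFreeProjectionPair M ω S T e a b κ σ τ r s t) : b ∈ M := by
  have := sub_mem h.proj_mem (M.toStarSubalgebra.smul_mem (one_mem M) r)
  rwa [add_sub_cancel_left] at this

theorem word_mem (h : IsFreeProjectionPair M ω S T e a b κ σ τ r s t) (m : ℕ) :
    (b * a) ^ m * b ∈ M :=
  mul_mem (pow_mem (mul_mem h.right_mem h.left_mem) m) h.right_mem

theorem apply_mul_word_mul (h : IsFreeProjectionPair M ω S T e a b κ σ τ r s t) (j k : Fin 2)
    (m : ℕ) : ω (e j * ((b * a) ^ m * b) * e k) = 0 := by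
  have h1 := h.free.eq_zero_of_isAltWord (IsAltWord.word h.mem_left h.mem_right m)
  have h2 := h.free.eq_zero_of_isAltWord
    ((IsAltWord.word h.mem_left h.mem_right m).mul_left h.mem_left)
  have h3 := h.free.eq_zero_of_isAltWord
    ((IsAltWord.left h.mem_left).mul_word h.mem_left h.mem_right m)
  have h4 := h.free.eq_zero_of_isAltWord
    (((IsAltWord.left h.mem_left).mul_word h.mem_left h.mem_right m).mul_left h.mem_left)
  rw [h.eq_smul j, h.eq_smul k]
  simp only [add_mul, mul_add, smul_mul_assoc, mul_smul_comm, one_mul, mul_one, map_add, map_smul,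
    h1, h2, h3, h4, smul_zero, add_zero]

/-- A centered (or off-diagonal) element of the algebra generated by the two projections may be
inserted between `F` and a tail-null `R` whenever reduced words may. -/
theorem apply_mul_mul_eq_zero (h : IsFreeProjectionPair M ω S T e a b κ σ τ r s t)
    {F n R : H →L[ℂ] H} {j k : Fin 2} (hF : F ∈ M) (hR : R ∈ M)
    (hFw : ∀ m, ω (F * ((b * a) ^ m * b) * R) = 0) (hFj : F * e j = F) (hRk : e k * R = R)
    (hn : n ∈ Set.centralizer (Set.centralizer {e 1, r • 1 + b})) (hnjk : e j * n * e k = n)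
    (hn0 : j ≠ k ∨ ω n = 0) : ω (F * n * R) = 0 := by
  set A := StarAlgebra.adjoin ℂ ({e 1, r • 1 + b} : Set (H →L[ℂ] H)) with hA
  have hAM : (A : Set (H →L[ℂ] H)) ⊆ M := by
    have : A ≤ M.toStarSubalgebra := by
      refine StarAlgebra.adjoin_le ?_
      rintro _ (rfl | rfl)
      exacts [h.mem 1, h.proj_mem]
    exact this
  have hAM' : Set.centralizer (Set.centralizer (A : Set (H →L[ℂ] H))) ⊆ (M : Set (H →L[ℂ] H)) := by
    rw [← M.centralizer_centralizer]
    exact Set.centralizer_subset (Set.centralizer_subset hAM)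
  have hnA : n ∈ Set.centralizer (Set.centralizer (A : Set (H →L[ℂ] H))) :=
    Set.centralizer_subset (Set.centralizer_subset (StarAlgebra.subset_adjoin ℂ _)) hn
  set C : ℂ := ω (F * R) / ω (e j) with hC
  have hC0 : j ≠ k → F * R = 0 := fun hjk => by
    rw [← hFj, ← hRk, mul_assoc, ← mul_assoc (e j), h.mul, if_neg hjk, zero_mul, mul_zero]
  let φ : (H →L[ℂ] H) →ₗ[ℂ] ℂ :=
    ω ∘ₗ LinearMap.mulLeftRight ℂ (F, R) - C • (ω ∘ₗ LinearMap.mulLeftRight ℂ (e j, e k))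
  have hφ : ∀ y, φ y = ω (F * y * R) - C * ω (e j * y * e k) := fun y => by
    simp [φ]
  have hφn : IsSeqNormalOn (Set.centralizer (Set.centralizer (A : Set (H →L[ℂ] H)))) φ := by
    refine IsSeqNormalOn.mono (M := M) (fun w Rk c hw hRk hc hlim => ?_) hAM'
    simp only [hφ]
    exact (h.normal.comp_mul_mul hF hR w Rk c hw hRk hc hlim).sub
      ((h.normal.comp_mul_mul (h.mem j) (h.mem k) w Rk c hw hRk hc hlim).const_mul C)
  have hφ0 : ∀ y ∈ A, φ y = 0 := by
    intro y hy
    have hy' : y ∈ Algebra.adjoin ℂ ({e 1, r • 1 + b} : Set (H →L[ℂ] H)) := by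
      rw [hA, ← StarSubalgebra.mem_toSubalgebra, StarAlgebra.adjoin_toSubalgebra] at hy
      have hstar : star ({e 1, r • 1 + b} : Set (H →L[ℂ] H)) = {e 1, r • 1 + b} := by
        rw [← Set.image_star, Set.image_pair, h.isSelfAdjoint, h.star_proj]
      rwa [hstar, Set.union_self] at hy
    have hle : Submodule.span ℂ
        (Set.range e ∪ {z | ∃ i j m, z = e i * ((b * a) ^ m * b) * e j}) ≤ LinearMap.ker φ := by
      rw [Submodule.span_le]
      rintro _ (⟨i, rfl⟩ | ⟨i, l, m, rfl⟩)
      · change φ _ = 0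
        rw [hφ, h.mul, ← hFj, mul_assoc F, h.mul]
        by_cases hji : j = i
        · subst hji
          simp only [if_true, h.mul, hFj]
          split_ifs with hjk
          · rw [hC, div_mul_cancel₀ _ (h.ne_zero j), sub_self]
          · rw [hC0 hjk]
            simp
        · simp [hji]
      · change φ _ = 0
        rw [hφ]
        have e1 : F * (e i * ((b * a) ^ m * b) * e l) * R =
            F * (e j * e i) * ((b * a) ^ m * b) * (e l * e k) * R := by
          nth_rewrite 1 [← hFj, ← hRk]
          simp only [mul_assoc]
        have e2 : e j * (e i * ((b * a) ^ m * b) * e l) * e k =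
            (e j * e i) * ((b * a) ^ m * b) * (e l * e k) := by
          simp only [mul_assoc]
        rw [e1, e2, h.mul, h.mul]
        split_ifs with hji hlk
        · subst hlk
          rw [h.apply_mul_word_mul, hFj, mul_assoc _ (e l) R, hRk, hFw, mul_zero, sub_zero]
        all_goals simp
    exact hle (mem_span_of_mem_adjoin_pair h.mul h.add h.eq_smul h.left_eq h.right_mul_self hy')
  have key := IsSeqNormalOn.eq_zero_of_mem_bicommutant A ω φ
    (fun m hm => h.nonneg m (hAM' hm)) (fun m hm => h.faithful m (hAM' hm)) hφn hφ0 hnA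
  rw [hφ, hnjk, sub_eq_zero] at key
  rw [key]
  obtain hjk | h0 := hn0
  · rw [hC, hC0 hjk]
    simp
  · rw [h0, mul_zero]

/-- Inserting an element of `S` and a centered element of the generated algebra preserves
tail-nullity, and the result is centered. -/
theorem isTailNull_mul_mul (h : IsFreeProjectionPair M ω S T e a b κ σ τ r s t)
    {g n R : H →L[ℂ] H} {j k : Fin 2} (hgS : g ∈ S) (hgM : g ∈ M) (hgj : g * e j = g)
    (hR : IsTailNull M ω S T R) (hRk : e k * R = R)
    (hn : n ∈ Set.centralizer (Set.centralizer {e 1, r • 1 + b})) (hnM : n ∈ M)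
    (hnjk : e j * n * e k = n) (hn0 : j ≠ k ∨ ω n = 0) :
    IsTailNull M ω S T (g * n * R) ∧ ω (g * n * R) = 0 := by
  refine ⟨⟨mul_mem (mul_mem hgM hnM) hR.1, fun u hu hu' => ?_⟩, ?_⟩
  · rw [← mul_assoc, ← mul_assoc]
    refine h.apply_mul_mul_eq_zero (mul_mem hu hgM) hR.1 (fun m => ?_) (by rw [mul_assoc, hgj]) hRk
      hn hnjk hn0
    exact hR.2 _ (mul_mem (mul_mem hu hgM) (h.word_mem m))
      ((hu'.mul_left hgS).mul_word h.mem_left h.mem_right m)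
  · refine h.apply_mul_mul_eq_zero hgM hR.1 (fun m => ?_) hgj hRk hn hnjk hn0
    exact hR.2 _ (mul_mem hgM (h.word_mem m))
      ((IsAltWord.left hgS).mul_word h.mem_left h.mem_right m)

theorem isTailNull_of_mem (h : IsFreeProjectionPair M ω S T e a b κ σ τ r s t)
    {g : H →L[ℂ] H} (hgS : g ∈ S) (hgM : g ∈ M) : IsTailNull M ω S T g :=
  ⟨hgM, fun _ _ hu => h.free.eq_zero_of_isAltWord (hu.mul_left hgS)⟩

theorem isTailNull_proj (h : IsFreeProjectionPair M ω S T e a b κ σ τ r s t) (i : Fin 2) :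
    IsTailNull M ω S T (e i) := by
  refine ⟨h.mem i, fun u hu hu' => ?_⟩
  rw [h.eq_smul, mul_add, mul_smul_comm, mul_smul_comm, mul_one, map_add, map_smul, map_smul,
    h.free.eq_zero_of_isAltWord hu', (h.isTailNull_of_mem h.mem_left h.left_mem).2 u hu hu']
  simp

theorem apply_proj_mul_mul_eq_zero (h : IsFreeProjectionPair M ω S T e a b κ σ τ r s t)
    {n R : H →L[ℂ] H} {j k : Fin 2} (hR : IsTailNull M ω S T R) (hRk : e k * R = R)
    (hn : n ∈ Set.centralizer (Set.centralizer {e 1, r • 1 + b}))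
    (hnjk : e j * n * e k = n) (hn0 : j ≠ k ∨ ω n = 0) : ω (e j * n * R) = 0 := by
  refine h.apply_mul_mul_eq_zero (h.mem j) hR.1 (fun m => ?_) (by rw [h.mul, if_pos rfl]) hRk
    hn hnjk hn0
  have h1 := hR.2 _ (h.word_mem m) (IsAltWord.word h.mem_left h.mem_right m)
  have h2 := hR.2 _ (mul_mem h.left_mem (h.word_mem m))
    ((IsAltWord.left h.mem_left).mul_word h.mem_left h.mem_right m)
  rw [h.eq_smul j]
  simp only [add_mul, smul_mul_assoc, one_mul, map_add, map_smul, h1, h2, smul_zero, add_zero]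

end IsFreeProjectionPair

end FreePair

/-- In the free product situation `(M₂(ℂ), ω_λ) ∗ (ℂ², τ_β)`, with
`p = p₁₁`, `u = p₀₁`, `v = u* x` and `ω_p = ω(p)⁻¹ ω` on the corner `pMp`, one has
`ω_p(v^k (v*)^l) = δ_{kl} λ^k` for all `k, l ≥ 0` (powers taken in the corner, whose
unit is `p`). -/
theorem freeProduct_corner_isometry_moments
    {H : Type*} [NormedAddCommGroup H] [InnerProductSpace ℂ H] [CompleteSpace H]
    (M : VonNeumannAlgebra H)
    (ω : (H →L[ℂ] H) →ₗ[ℂ] ℂ)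
    -- `ω` is a faithful normal state on `M`
    (hω1 : ω 1 = 1)
    (hωpos : ∀ m ∈ M, 0 ≤ ω (star m * m))
    (hωfaith : ∀ m ∈ M, ω (star m * m) = 0 → m = 0)
    (hωnormal : ∀ (w : H →L[ℂ] H) (R : ℕ → H →L[ℂ] H) (c : ℝ),
      w ∈ M → (∀ k, R k ∈ M) → (∀ k, ‖R k‖ ≤ c) →
      (∀ ξ : H, Tendsto (fun k => R k ξ) atTop (𝓝 (w ξ))) →
      Tendsto (fun k => ω (R k)) atTop (𝓝 (ω w)))
    (lam β : ℝ) (hlam0 : 0 < lam) (hlam1 : lam < 1) (hβ0 : 0 < β) (hβ1 : β < 1)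
    -- the matrix units `p_{ij}` spanning a copy of `M₂(ℂ)`
    (pm : Fin 2 → Fin 2 → (H →L[ℂ] H))
    (hpmM : ∀ i j, pm i j ∈ M)
    (hpmstar : ∀ i j, star (pm i j) = pm j i)
    (hpmmul : ∀ i j k l, pm i j * pm k l = if j = k then pm i l else 0)
    (hpmone : pm 0 0 + pm 1 1 = 1)
    (hpmω : ∀ i j, ω (pm i j) =
      if i = j then ((lam ^ (j : ℕ) / (lam + 1) : ℝ) : ℂ) else 0)
    -- the projection `q` spanning, together with `1`, a copy of `ℂ²`
    (q : H →L[ℂ] H) (hqM : q ∈ M) (hqstar : star q = q) (hqidem : q * q = q)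
    (hqω : ω q = (β : ℂ))
    -- freeness of `A = span(p_{ij})` and `B = span{1, q}` with respect to `ω`
    (hfree : FreeOn ω
      {m | m ∈ Submodule.span ℂ {y : H →L[ℂ] H | ∃ i j, y = pm i j} ∧ ω m = 0}
      {m | m ∈ Submodule.span ℂ ({1, q} : Set (H →L[ℂ] H)) ∧ ω m = 0})
    (p u : H →L[ℂ] H) (hp : p = pm 1 1) (hu : u = pm 0 1)
    -- `N` is the von Neumann subalgebra generated by `p` and `q`
    (N : Set (H →L[ℂ] H)) (hN : N = Set.centralizer (Set.centralizer {p, q}))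
    -- the elements `x, z ∈ N` furnished by Voiculescu's description
    (x z : H →L[ℂ] H) (hxN : x ∈ N) (hzN : z ∈ N)
    (hxx : star x * x = p)
    (hxxle : (1 - p) * (x * star x) = x * star x)
    (hωx : ω x = 0)
    (hωxx : ω (x * star x) = ((lam / (lam + 1) : ℝ) : ℂ))
    (hzstar : star z = z) (hzidem : z * z = z)
    (hzle : (1 - p) * z = z) (hzx : z * x = x)
    (hωz : ω z = (β : ℂ))
    -- the isometry `v = u* x` of the corner `pMp`, and the corner state `ω_p`
    (v : H →L[ℂ] H) (hv : v = star u * x)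
    (ωp : (H →L[ℂ] H) → ℂ) (hωp : ∀ m, ωp m = (ω p)⁻¹ * ω m) :
    ∀ k l : ℕ, ωp (v ^ k * p * (star v) ^ l) =
      if k = l then ((lam : ℂ)) ^ k else 0 := by
  have hpos : (0 : ℝ) < lam + 1 := by linarith
  have hlamC : (lam : ℂ) + 1 ≠ 0 := by exact_mod_cast hpos.ne'
  have hlamC0 : (lam : ℂ) ≠ 0 := by exact_mod_cast hlam0.ne'
  have hω00 : ω (pm 0 0) = 1 / ((lam : ℂ) + 1) := by simp [hpmω]
  have hω11 : ω (pm 1 1) = (lam : ℂ) / ((lam : ℂ) + 1) := by simp [hpmω]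
  have hω01 : ω (pm 0 1) = 0 := by simp [hpmω]
  have hω10 : ω (pm 1 0) = 0 := by simp [hpmω]
  subst hp hu
  set α : ℂ := (lam : ℂ) / ((lam : ℂ) + 1) with hα
  have hα0 : α ≠ 0 := div_ne_zero hlamC0 hlamC
  set S : Set (H →L[ℂ] H) :=
    {m | m ∈ Submodule.span ℂ {y : H →L[ℂ] H | ∃ i j, y = pm i j} ∧ ω m = 0} with hS
  set T : Set (H →L[ℂ] H) :=
    {m | m ∈ Submodule.span ℂ ({1, q} : Set (H →L[ℂ] H)) ∧ ω m = 0} with hT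
  have hpmspan : ∀ i j, pm i j ∈ Submodule.span ℂ {y : H →L[ℂ] H | ∃ i j, y = pm i j} :=
    fun i j => Submodule.subset_span ⟨i, j, rfl⟩
  have h0eq : pm 0 0 = 1 - pm 1 1 := eq_sub_of_add_eq hpmone
  have hq : (β : ℂ) • (1 : H →L[ℂ] H) + (q - (β : ℂ) • 1) = q := by abel
  have hF : IsFreeProjectionPair M ω S T (fun i => pm i i) (pm 1 1 - α • 1) (q - (β : ℂ) • 1)
      ![1 - α, α] ![-1, 1] ![-α, 1 - α] (β : ℂ) ((β : ℂ) * (1 - β)) (1 - 2 * β) :=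
    { nonneg := hωpos
      faithful := hωfaith
      normal := hωnormal
      free := hfree
      mem_left := by
        refine ⟨sub_mem (hpmspan 1 1) (Submodule.smul_mem _ _ ?_), ?_⟩
        · rw [← hpmone]
          exact add_mem (hpmspan 0 0) (hpmspan 1 1)
        · simp [hω1, hω11]
      mem_right := by
        refine ⟨sub_mem (Submodule.subset_span (by simp))
          (Submodule.smul_mem _ _ (Submodule.subset_span (by simp))), ?_⟩
        simp [hω1, hqω]
      mem := fun i => hpmM i i
      isSelfAdjoint := fun i => hpmstar i i
      mul := fun i j => by
        rw [hpmmul]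
        split_ifs with h
        · rw [h]
        · rfl
      add := hpmone
      ne_zero := fun i => by
        fin_cases i
        · simpa [hω00] using hlamC
        · simpa [hω11] using hα0
      eq_smul := fun i => by
        fin_cases i
        · simp only [Fin.zero_eta, h0eq, Matrix.cons_val_zero]
          module
        · simp only [Fin.mk_one, Matrix.cons_val_one, Matrix.cons_val_fin_one]
          module
      left_eq := by
        simp only [h0eq, Matrix.cons_val_zero, Matrix.cons_val_one, Matrix.cons_val_fin_one]
        module
      right_mul_self := by
        simp only [sub_mul, mul_sub, hqidem, smul_mul_assoc, mul_smul_comm, one_mul, mul_one]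
        module
      proj_mem := by rwa [hq]
      star_proj := by rw [hq, hqstar] }
  have hgen : N = Set.centralizer
      (Set.centralizer {(fun i => pm i i) (1 : Fin 2), (β : ℂ) • 1 + (q - (β : ℂ) • 1)}) := by
    rw [hN, hq]
  have hNM : N ⊆ (M : Set (H →L[ℂ] H)) := by
    rw [hN, ← M.centralizer_centralizer]
    refine Set.centralizer_subset (Set.centralizer_subset ?_)
    rintro _ (rfl | rfl)
    exacts [hpmM 1 1, hqM]
  have hNstar : ∀ y ∈ N, star y ∈ N := by
    rw [hN]
    have h1 : ∀ y ∈ Set.centralizer ({pm 1 1, q} : Set (H →L[ℂ] H)),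
        star y ∈ Set.centralizer ({pm 1 1, q} : Set (H →L[ℂ] H)) := by
      intro y hy w hw
      have hws : star w = w := by
        obtain rfl | rfl := hw
        exacts [hpmstar 1 1, hqstar]
      simpa [hws] using (congrArg star (hy w hw)).symm
    intro y hy c hc
    simpa using (congrArg star (hy (star c) (h1 c hc))).symm
  have hNsub : {pm 1 1, q} ⊆ N := hN ▸ Set.subset_centralizer_centralizer
  have hpN : pm 1 1 ∈ N := hNsub (by simp)
  have hxp : x * pm 1 1 = x := by
    have h1 : star (x - x * pm 1 1) * (x - x * pm 1 1) = 0 := by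
      have hpp : pm 1 1 * pm 1 1 = pm 1 1 := by simp [hpmmul]
      rw [star_sub, star_mul, hpmstar, mul_sub, sub_mul, sub_mul, ← mul_assoc (star x), hxx,
        mul_assoc _ (star x), mul_assoc _ (star x), ← mul_assoc (star x) x, hxx, hpp, hpp]
      simp
    exact (sub_eq_zero.1 (CStarRing.star_mul_self_eq_zero_iff _ |>.1 h1)).symm
  have hpx : pm 1 1 * x = 0 := by
    refine CStarRing.mul_star_self_eq_zero_iff _ |>.1 ?_
    have h2 : pm 1 1 * (x * star x) = 0 := by
      rw [sub_mul, one_mul] at hxxle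
      simpa using hxxle
    rw [star_mul, mul_assoc, ← mul_assoc x, ← mul_assoc (pm 1 1), h2, zero_mul]
  have h0x : pm 0 0 * x = x := by rw [h0eq, sub_mul, one_mul, hpx, sub_zero]
  have hsx0 : star x * pm 0 0 = star x := by
    simpa [hpmstar] using congrArg star h0x
  have hpsx : pm 1 1 * star x = star x := by
    simpa [hpmstar] using congrArg star hxp
  have hxs : star x ∈ N := hNstar x hxN
  have h10S : pm 1 0 ∈ S := ⟨hpmspan 1 0, hω10⟩
  have h01S : pm 0 1 ∈ S := ⟨hpmspan 0 1, hω01⟩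
  set y : H →L[ℂ] H := x * star x - (lam : ℂ) • pm 0 0 with hy
  have hyω : ω y = 0 := by
    rw [hy, map_sub, map_smul, hωxx, hω00]
    push_cast
    simp [div_eq_mul_inv]
  have hyN : y ∈ N := by
    rw [hN] at hxN hxs hpN ⊢
    have h0 : pm 0 0 ∈ Set.centralizer (Set.centralizer ({pm 1 1, q} : Set (H →L[ℂ] H))) := by
      rw [h0eq, sub_eq_add_neg]
      exact Set.add_mem_centralizer Set.one_mem_centralizer (Set.neg_mem_centralizer hpN)
    rw [hy, sub_eq_add_neg, ← neg_smul]
    refine Set.add_mem_centralizer (Set.mul_mem_centralizer hxN hxs) fun c hc => ?_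
    exact Commute.smul_right (h0 c hc) _
  have hy00 : pm 0 0 * y * pm 0 0 = y := by
    rw [hy, mul_sub, sub_mul, ← mul_assoc, h0x, mul_assoc, hsx0]
    simp [hpmmul]
  have hxω : pm 0 0 * x * pm 1 1 = x := by rw [h0x, hxp]
  have hsxω : pm 1 1 * star x * pm 0 0 = star x := by rw [hpsx, hsx0]
  have hveq : v = pm 1 0 * x := by rw [hv, hpmstar]
  have hsv : star v = star x * pm 0 1 := by rw [hveq, star_mul, hpmstar]
  have hpv : pm 1 1 * v = v := by
    rw [hveq, ← mul_assoc]
    simp [hpmmul]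
  have hvR : ∀ R, IsTailNull M ω S T R → pm 1 1 * R = R →
      IsTailNull M ω S T (v * R) ∧ ω (v * R) = 0 := fun R hR hpR => by
    rw [hveq]
    exact hF.isTailNull_mul_mul (j := 0) (k := 1) h10S (hpmM 1 0) (by simp [hpmmul]) hR hpR
      (hgen ▸ hxN) (hNM hxN) hxω (.inl (by decide))
  have hvpow : ∀ (k : ℕ) (R : H →L[ℂ] H), IsTailNull M ω S T R → pm 1 1 * R = R →
      IsTailNull M ω S T (v ^ k * R) ∧ pm 1 1 * (v ^ k * R) = v ^ k * R := by
    intro k R hR hpR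
    induction k with
    | zero => simpa using ⟨hR, hpR⟩
    | succ k ih =>
      rw [pow_succ', mul_assoc]
      exact ⟨(hvR _ ih.1 ih.2).1, by rw [← mul_assoc, hpv]⟩
  have hvpow0 : ∀ (k : ℕ) (R : H →L[ℂ] H), IsTailNull M ω S T R → pm 1 1 * R = R →
      ω (v ^ (k + 1) * R) = 0 := fun k R hR hpR => by
    rw [pow_succ', mul_assoc]
    exact (hvR _ (hvpow k R hR hpR).1 (hvpow k R hR hpR).2).2
  have htail0 : ∀ l : ℕ, pm 0 0 * (pm 0 1 * star v ^ l) = pm 0 1 * star v ^ l := fun l => by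
    rw [← mul_assoc]
    simp [hpmmul]
  have htail : ∀ l : ℕ, IsTailNull M ω S T (pm 0 1 * star v ^ l) := by
    intro l
    induction l with
    | zero => simpa using hF.isTailNull_of_mem h01S (hpmM 0 1)
    | succ l ih =>
      have h1 : pm 0 1 * star v ^ (l + 1) = pm 0 1 * star x * (pm 0 1 * star v ^ l) := by
        rw [pow_succ']
        nth_rewrite 1 [hsv]
        simp only [mul_assoc]
      rw [h1]
      exact (hF.isTailNull_mul_mul (j := 1) (k := 0) h01S (hpmM 0 1) (by simp [hpmmul]) ih
        (htail0 l) (hgen ▸ hxs) (hNM hxs) hsxω (.inl (by decide))).1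
  have hmain : ∀ k l : ℕ, ω (v ^ k * pm 1 1 * star v ^ l) =
      if k = l then (lam : ℂ) ^ k * α else 0 := by
    intro k
    induction k with
    | zero =>
      intro l
      cases l with
      | zero => simp [hω11]
      | succ l =>
        have h1 : v ^ 0 * pm 1 1 * star v ^ (l + 1) =
            pm 1 1 * star x * (pm 0 1 * star v ^ l) := by
          rw [pow_succ', pow_zero, one_mul]
          nth_rewrite 1 [hsv]
          simp only [mul_assoc]
        rw [h1, if_neg (by lia)]
        exact hF.apply_proj_mul_mul_eq_zero (j := 1) (k := 0) (htail l) (htail0 l) (hgen ▸ hxs)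
          hsxω (.inl (by decide))
    | succ k ih =>
      intro l
      cases l with
      | zero =>
        rw [if_neg (by lia), pow_zero, mul_one]
        exact hvpow0 k _ (hF.isTailNull_proj 1) (by simp [hpmmul])
      | succ l =>
        have hxx' : x * star x = y + (lam : ℂ) • pm 0 0 := by rw [hy, sub_add_cancel]
        have h1 : v ^ (k + 1) * pm 1 1 * star v ^ (l + 1) =
            v ^ k * (pm 1 0 * y * (pm 0 1 * star v ^ l)) +
              (lam : ℂ) • (v ^ k * pm 1 1 * star v ^ l) := by
          calc v ^ (k + 1) * pm 1 1 * star v ^ (l + 1)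
              = v ^ k * (v * pm 1 1 * star v * star v ^ l) := by
                rw [pow_succ, pow_succ']
                simp only [mul_assoc]
            _ = v ^ k * (pm 1 0 * (x * pm 1 1 * star x) * (pm 0 1 * star v ^ l)) := by
                congr 1
                rw [hsv]
                nth_rewrite 1 [hveq]
                simp only [mul_assoc]
            _ = v ^ k * (pm 1 0 * (x * star x) * (pm 0 1 * star v ^ l)) := by rw [hxp]
            _ = v ^ k * (pm 1 0 * y * (pm 0 1 * star v ^ l)) +
                (lam : ℂ) • (v ^ k * (pm 1 0 * pm 0 0 * pm 0 1 * star v ^ l)) := by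
                rw [hxx']
                simp only [mul_add, add_mul, mul_smul_comm, smul_mul_assoc, mul_assoc]
            _ = _ := by simp [hpmmul, mul_assoc]
        obtain ⟨h2, h3⟩ := hF.isTailNull_mul_mul (j := 0) (k := 0) h10S (hpmM 1 0)
          (by simp [hpmmul]) (htail l) (htail0 l) (hgen ▸ hyN) (hNM hyN) hy00 (.inr hyω)
        have h4 : ω (v ^ k * (pm 1 0 * y * (pm 0 1 * star v ^ l))) = 0 := by
          cases k with
          | zero => simpa using h3
          | succ k =>
            refine hvpow0 k _ h2 ?_
            rw [mul_assoc (pm 1 0), ← mul_assoc (pm 1 1), hpmmul, if_pos rfl]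
        rw [h1, map_add, map_smul, h4, ih l, zero_add, smul_eq_mul]
        by_cases hkl : k = l
        · subst hkl
          simp only [if_true, pow_succ]
          ring
        · simp [hkl]
  intro k l
  rw [hωp, hmain, hω11]
  split_ifs
  · field_simp
  · simp
end

section
/- For all integers k, l ≥ 0 one has ω_p(v^k P (v*)^l) = δ_{kl} γ λ^k, where γ = β(λ+1). -/
open Filter Topology
open scoped ComplexOrder

section Bicommutant

variable {H : Type*} [NormedAddCommGroup H] [InnerProductSpace ℂ H]

/-- The diagonal amplification of an operator to a finite Hilbert sum. -/
noncomputable def diagAmplify {ι : Type*} [Fintype ι] (a : H →L[ℂ] H) :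
    PiLp 2 (fun _ : ι => H) →L[ℂ] PiLp 2 (fun _ : ι => H) :=
  (PiLp.continuousLinearEquiv 2 ℂ (fun _ : ι => H)).symm.toContinuousLinearMap ∘L
    ContinuousLinearMap.pi (fun i => a ∘L PiLp.proj 2 (fun _ : ι => H) i)

@[simp]
theorem diagAmplify_apply {ι : Type*} [Fintype ι] (a : H →L[ℂ] H)
    (w : PiLp 2 (fun _ : ι => H)) (i : ι) : diagAmplify a w i = a (w i) := rfl

variable [CompleteSpace H]

theorem star_diagAmplify {ι : Type*} [Fintype ι] (a : H →L[ℂ] H) :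
    star (diagAmplify (ι := ι) a) = diagAmplify (star a) := by
  rw [ContinuousLinearMap.star_eq_adjoint]
  refine ((ContinuousLinearMap.eq_adjoint_iff _ _).2 fun v w => ?_).symm
  simp [PiLp.inner_apply, ContinuousLinearMap.star_eq_adjoint,
    ContinuousLinearMap.adjoint_inner_left]

theorem commute_starProjection {E : Type*} [NormedAddCommGroup E] [InnerProductSpace ℂ E]
    [CompleteSpace E] (K : Submodule ℂ E) [K.HasOrthogonalProjection] (T : E →L[ℂ] E)
    (hT : ∀ v ∈ K, T v ∈ K) (hT' : ∀ v ∈ K, star T v ∈ K) :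
    T * K.starProjection = K.starProjection * T := by
  ext v
  refine (Submodule.eq_starProjection_of_mem_orthogonal' (hT _ (K.starProjection_apply_mem v))
    (z := T (v - K.starProjection v)) ?_ (by simp)).symm
  rw [Submodule.mem_orthogonal]
  intro w hw
  rw [← ContinuousLinearMap.adjoint_inner_left]
  exact Submodule.inner_right_of_mem_orthogonal (hT' w hw)
    (K.sub_starProjection_mem_orthogonal v)

theorem exists_seq_tendsto_of_mem_bicommutant (A : StarSubalgebra ℂ (H →L[ℂ] H))
    {m : H →L[ℂ] H} (hm : m ∈ Set.centralizer (Set.centralizer (A : Set (H →L[ℂ] H))))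
    {ι : Type*} [Fintype ι] (η : ι → H) :
    ∃ a : ℕ → H →L[ℂ] H, (∀ k, a k ∈ A) ∧
      ∀ i, Tendsto (fun k => a k (η i)) atTop (𝓝 (m (η i))) := by
  classical
  let v : PiLp 2 (fun _ : ι => H) := WithLp.toLp 2 η
  let K₀ : Submodule ℂ (PiLp 2 (fun _ : ι => H)) :=
    { carrier := {w | ∃ a ∈ A, w = diagAmplify a v}
      add_mem' := by
        rintro _ _ ⟨a, ha, rfl⟩ ⟨b, hb, rfl⟩
        exact ⟨a + b, add_mem ha hb, by ext i; simp⟩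
      zero_mem' := ⟨0, zero_mem A, by ext i; simp⟩
      smul_mem' := by
        rintro c _ ⟨a, ha, rfl⟩
        exact ⟨c • a, SMulMemClass.smul_mem c ha, by ext i; simp⟩ }
  let K := K₀.topologicalClosure
  have hK : ∀ a ∈ A, ∀ w ∈ K, diagAmplify a w ∈ K := by
    intro a ha w hw
    have h1 : Set.MapsTo (diagAmplify (ι := ι) a) (K₀ : Set (PiLp 2 (fun _ : ι => H)))
        (K₀ : Set (PiLp 2 (fun _ : ι => H))) := by
      rintro _ ⟨b, hb, rfl⟩
      exact ⟨a * b, mul_mem ha hb, by ext i; simp⟩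
    exact h1.closure (diagAmplify a).continuous hw
  have : CompleteSpace K := K₀.isClosed_topologicalClosure.completeSpace_coe
  let e := K.starProjection
  have hcomm : ∀ a ∈ A, ∀ w, diagAmplify a (e w) = e (diagAmplify a w) := fun a ha w =>
    DFunLike.congr_fun (commute_starProjection K (diagAmplify a) (hK a ha)
      (by rw [star_diagAmplify]; exact hK _ (star_mem ha))) w
  let sg : ι → H →L[ℂ] PiLp 2 (fun _ : ι => H) := fun j =>
    (PiLp.continuousLinearEquiv 2 ℂ (fun _ : ι => H)).symm.toContinuousLinearMap ∘L
      ContinuousLinearMap.single ℂ (fun _ : ι => H) j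
  have hsg : ∀ (a : H →L[ℂ] H) j ξ, sg j (a ξ) = diagAmplify a (sg j ξ) := by
    intro a j ξ
    ext i
    rcases eq_or_ne i j with rfl | h
    · simp [sg]
    · simp [sg, h]
  have hsum : ∀ w : PiLp 2 (fun _ : ι => H), w = ∑ j, sg j (w j) := by
    intro w
    ext i
    simp [sg, WithLp.ofLp_sum, Finset.sum_apply, Pi.single_apply]
  let ee : ι → ι → H →L[ℂ] H := fun i j => PiLp.proj 2 (fun _ : ι => H) i ∘L e ∘L sg j
  have hee : ∀ i j, ee i j ∈ Set.centralizer (A : Set (H →L[ℂ] H)) := by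
    intro i j a ha
    ext ξ
    have := congrArg (fun w : PiLp 2 (fun _ : ι => H) => w i) (hcomm a ha (sg j ξ))
    simpa [ee, hsg] using this
  have hmcomm : ∀ w : PiLp 2 (fun _ : ι => H), diagAmplify m (e w) = e (diagAmplify m w) := by
    intro w
    ext i
    have h2 : ∀ w : PiLp 2 (fun _ : ι => H), e w i = ∑ j, ee i j (w j) := by
      intro w
      conv_lhs => rw [hsum w]
      rw [map_sum]
      simp [ee, WithLp.ofLp_sum, Finset.sum_apply]
    rw [diagAmplify_apply, h2, h2, map_sum]
    refine Finset.sum_congr rfl fun j _ => ?_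
    exact (DFunLike.congr_fun (hm _ (hee i j)) (w j)).symm
  have hv : v ∈ K := K₀.le_topologicalClosure ⟨1, one_mem A, by ext i; simp⟩
  have hmv : diagAmplify m v ∈ K := by
    have h := hmcomm v
    rw [Submodule.starProjection_eq_self_iff.2 hv] at h
    exact Submodule.starProjection_eq_self_iff.1 h.symm
  obtain ⟨x, hx, hxlim⟩ := mem_closure_iff_seq_limit.1
    (show diagAmplify m v ∈ closure (K₀ : Set (PiLp 2 (fun _ : ι => H)))
    from hmv)
  choose a ha hax using hx
  refine ⟨a, ha, fun i => ?_⟩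
  have := ((PiLp.proj (𝕜 := ℂ) 2 (fun _ : ι => H) i).continuous.tendsto _).comp hxlim
  simpa [Function.comp_def, hax, v] using this

theorem exists_seq_isSelfAdjoint_tendsto (A : StarSubalgebra ℂ (H →L[ℂ] H))
    {m : H →L[ℂ] H} (hm : m ∈ Set.centralizer (Set.centralizer (A : Set (H →L[ℂ] H))))
    (hsa : IsSelfAdjoint m) {ι : Type*} [Fintype ι] (η : ι → H) :
    ∃ a : ℕ → H →L[ℂ] H, (∀ k, a k ∈ A ∧ IsSelfAdjoint (a k)) ∧
      ∀ i, Tendsto (fun k => a k (η i)) atTop (𝓝 (m (η i))) := by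
  classical
  let s : Set (ι → H) := {w | ∃ a ∈ A, IsSelfAdjoint a ∧ w = fun i => a (η i)}
  have hs : Convex ℝ s := by
    rintro _ ⟨a, ha, hasa, rfl⟩ _ ⟨b, hb, hbsa, rfl⟩ t r - - -
    refine ⟨(t : ℂ) • a + (r : ℂ) • b, add_mem (SMulMemClass.smul_mem _ ha)
      (SMulMemClass.smul_mem _ hb), ?_, ?_⟩
    · exact (IsSelfAdjoint.smul (by simp [IsSelfAdjoint]) hasa).add
        (IsSelfAdjoint.smul (by simp [IsSelfAdjoint]) hbsa)
    · ext i
      simp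
  suffices hmem : (fun i => m (η i)) ∈ closure s by
    obtain ⟨x, hx, hxlim⟩ := mem_closure_iff_seq_limit.1 hmem
    choose a ha hasa hax using hx
    refine ⟨a, fun k => ⟨ha k, hasa k⟩, fun i => ?_⟩
    have := (tendsto_pi_nhds.1 hxlim) i
    simpa [hax] using this
  by_contra hnot
  obtain ⟨f, t, hf1, hf2⟩ := RCLike.geometric_hahn_banach_closed_point (𝕜 := ℂ) hs.closure
    isClosed_closure hnot
  choose ζ hζ using fun i => (InnerProductSpace.toDual ℂ H).surjective
    (f ∘L ContinuousLinearMap.single ℂ (fun _ : ι => H) i)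
  have hfsum : ∀ w : ι → H, f w = ∑ i, inner ℂ (ζ i) (w i) := by
    intro w
    have : ∀ i, inner ℂ (ζ i) (w i) = f (Pi.single i (w i)) := by
      intro i
      have := DFunLike.congr_fun (hζ i) (w i)
      simpa using this
    simp_rw [this, ← map_sum, Finset.univ_sum_single]
  have hzero : ∀ a ∈ A, IsSelfAdjoint a → RCLike.re (f fun i => a (η i)) = 0 := by
    intro a ha hasa
    by_contra hne
    set r := RCLike.re (f fun i => a (η i)) with hr
    have := hf1 _ (subset_closure ⟨((t / r : ℝ) : ℂ) • a, SMulMemClass.smul_mem _ ha,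
      IsSelfAdjoint.smul (by simp [IsSelfAdjoint]) hasa, rfl⟩)
    have h2 : (fun i => (((t / r : ℝ) : ℂ) • a) (η i)) = ((t / r : ℝ) : ℂ) • fun i => a (η i) := rfl
    rw [h2, map_smul, smul_eq_mul, RCLike.re_eq_complex_re, Complex.re_ofReal_mul] at this
    rw [RCLike.re_eq_complex_re] at hr
    rw [← hr, div_mul_cancel₀ _ hne] at this
    exact lt_irrefl _ this
  have ht : 0 < t := by
    have := hf1 _ (subset_closure ⟨0, zero_mem A, IsSelfAdjoint.zero _, rfl⟩)
    simpa [hfsum] using this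
  obtain ⟨a, ha, halim⟩ := exists_seq_tendsto_of_mem_bicommutant A hm (Sum.elim η ζ)
  have hlim1 : Tendsto (fun k => ∑ i, (inner ℂ (ζ i) (a k (η i)) + inner ℂ (a k (ζ i)) (η i)))
      atTop (𝓝 (∑ i, (inner ℂ (ζ i) (m (η i)) + inner ℂ (m (ζ i)) (η i)))) :=
    tendsto_finsetSum _ fun i _ =>
      (tendsto_const_nhds.inner (halim (Sum.inl i))).add
        ((halim (Sum.inr i)).inner tendsto_const_nhds)
  have hmm : ∑ i, (inner ℂ (ζ i) (m (η i)) + inner ℂ (m (ζ i)) (η i))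
      = 2 * f fun i => m (η i) := by
    rw [hfsum, Finset.mul_sum]
    refine Finset.sum_congr rfl fun i _ => ?_
    rw [← ContinuousLinearMap.adjoint_inner_right m, ← ContinuousLinearMap.star_eq_adjoint,
      hsa.star_eq, two_mul]
  have hk : ∀ k, (∑ i, (inner ℂ (ζ i) (a k (η i)) + inner ℂ (a k (ζ i)) (η i)) : ℂ).re = 0 := by
    intro k
    have := hzero (a k + star (a k)) (add_mem (ha k) (star_mem (ha k)))
      (IsSelfAdjoint.add_star_self _)
    rw [hfsum] at this
    rw [← RCLike.re_eq_complex_re, ← this]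
    congr 1
    refine Finset.sum_congr rfl fun i _ => ?_
    rw [add_apply, inner_add_right, ContinuousLinearMap.star_eq_adjoint,
      ContinuousLinearMap.adjoint_inner_right]
  have hre := (Complex.continuous_re.tendsto _).comp hlim1
  simp only [Function.comp_def, hk, hmm] at hre
  have h0 := tendsto_nhds_unique hre tendsto_const_nhds
  rw [RCLike.re_eq_complex_re] at hf2
  simp at h0
  linarith

theorem exists_seq_isSelfAdjoint_tendsto_of_countable (A : StarSubalgebra ℂ (H →L[ℂ] H))
    {m : H →L[ℂ] H} (hm : m ∈ Set.centralizer (Set.centralizer (A : Set (H →L[ℂ] H))))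
    (hsa : IsSelfAdjoint m) {S : Set H} (hS : S.Countable) :
    ∃ a : ℕ → H →L[ℂ] H, (∀ k, a k ∈ A ∧ IsSelfAdjoint (a k)) ∧
      ∀ ξ ∈ S, Tendsto (fun k => a k ξ) atTop (𝓝 (m ξ)) := by
  rcases S.eq_empty_or_nonempty with rfl | hne
  · exact ⟨fun _ => 0, fun _ => ⟨zero_mem A, IsSelfAdjoint.zero _⟩, by simp⟩
  obtain ⟨η, rfl⟩ := hS.exists_eq_range hne
  have key : ∀ k : ℕ, ∃ a : H →L[ℂ] H, (a ∈ A ∧ IsSelfAdjoint a) ∧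
      ∀ j : Fin (k + 1), dist (a (η j)) (m (η j)) < 1 / ((k : ℝ) + 1) := by
    intro k
    obtain ⟨a, ha, hlim⟩ := exists_seq_isSelfAdjoint_tendsto A hm hsa
      (fun j : Fin (k + 1) => η j)
    have : ∀ᶠ n in atTop, ∀ j : Fin (k + 1), dist (a n (η j)) (m (η j)) < 1 / ((k : ℝ) + 1) :=
      eventually_all.2 fun j => (Metric.tendsto_nhds.1 (hlim j)) _ (by positivity)
    obtain ⟨n, hn⟩ := this.exists
    exact ⟨a n, ha n, hn⟩
  choose a ha hlim using key
  refine ⟨a, ha, ?_⟩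
  rintro _ ⟨j, rfl⟩
  rw [tendsto_iff_dist_tendsto_zero]
  refine squeeze_zero' (Eventually.of_forall fun _ => dist_nonneg) ?_
    tendsto_one_div_add_atTop_nhds_zero_nat
  filter_upwards [eventually_ge_atTop j] with k hk
  exact (hlim k ⟨j, by omega⟩).le

end Bicommutant

section BoundedApproximation

variable {H : Type*} [NormedAddCommGroup H] [InnerProductSpace ℂ H]

theorem tendsto_resolvent_apply {m : H →L[ℂ] H} {a : ℕ → H →L[ℂ] H} {c : ℂ} {ξ : H}
    (hm : IsUnit (m + c • 1)) (ha : ∀ k, IsUnit (a k + c • 1))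
    (hnorm : ∀ k, ‖(↑(ha k).unit⁻¹ : H →L[ℂ] H)‖ ≤ 1)
    (hlim : Tendsto (fun k => a k ((↑hm.unit⁻¹ : H →L[ℂ] H) ξ)) atTop
      (𝓝 (m ((↑hm.unit⁻¹ : H →L[ℂ] H) ξ)))) :
    Tendsto (fun k => (↑(ha k).unit⁻¹ : H →L[ℂ] H) ξ) atTop
      (𝓝 ((↑hm.unit⁻¹ : H →L[ℂ] H) ξ)) := by
  rw [tendsto_iff_norm_sub_tendsto_zero] at hlim ⊢
  refine squeeze_zero (fun _ => norm_nonneg _) (fun k => ?_) hlim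
  set r := (↑hm.unit⁻¹ : H →L[ℂ] H)
  set s := (↑(ha k).unit⁻¹ : H →L[ℂ] H)
  have h1 : s ξ - r ξ = s (-(a k (r ξ) - m (r ξ))) := by
    have hr := DFunLike.congr_fun hm.mul_val_inv ξ
    have hs := DFunLike.congr_fun (ha k).val_inv_mul (r ξ)
    have hr' : m (r ξ) + c • r ξ = ξ := hr
    have hs' : s (a k (r ξ)) + c • s (r ξ) = r ξ := by
      rw [← map_smul, ← map_add]
      exact hs
    have : s ξ = s (m (r ξ)) + c • s (r ξ) := by
      conv_lhs => rw [← hr']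
      simp
    rw [this, map_neg, map_sub, eq_sub_iff_add_eq'.2 hs']
    abel
  rw [h1]
  refine (s.le_of_opNorm_le (hnorm k) _).trans ?_
  rw [one_mul, norm_neg]

variable [CompleteSpace H]

theorem IsSelfAdjoint.exists_resolvent {a : H →L[ℂ] H} (ha : IsSelfAdjoint a) {c : ℂ}
    (hc : |c.im| = 1) :
    ∃ h : IsUnit (a + c • 1), ‖(↑h.unit⁻¹ : H →L[ℂ] H)‖ ≤ 1 := by
  have hne : c.im ≠ 0 := by
    intro h
    simp [h] at hc
  have h : IsUnit (a + c • 1) := by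
    have h1 : -c ∉ spectrum ℂ a := fun hmem => by
      have := ha.im_eq_zero_of_mem_spectrum hmem
      simp [hne] at this
    have h2 := (spectrum.notMem_iff.1 h1).neg
    have h3 : -((algebraMap ℂ (H →L[ℂ] H)) (-c) - a) = a + c • 1 := by
      rw [Algebra.algebraMap_eq_smul_one, neg_smul]
      abel
    rwa [h3] at h2
  refine ⟨h, ContinuousLinearMap.opNorm_le_bound _ zero_le_one fun w => ?_⟩
  set ξ := (↑h.unit⁻¹ : H →L[ℂ] H) w with hξ
  have hw : w = a ξ + c • ξ := by
    exact (DFunLike.congr_fun h.mul_val_inv w).symm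
  have h0 : (inner ℂ ξ (a ξ)).im = 0 := by
    have := ContinuousLinearMap.adjoint_inner_left a ξ ξ
    rw [← ContinuousLinearMap.star_eq_adjoint, ha.star_eq] at this
    rw [← Complex.conj_eq_iff_im, inner_conj_symm, this]
  have him : (inner ℂ ξ w).im = c.im * ‖ξ‖ ^ 2 := by
    rw [hw, inner_add_right, inner_smul_right, inner_self_eq_norm_sq_to_K, Complex.add_im, h0]
    norm_cast
    rw [zero_add]
    exact Complex.im_mul_ofReal _ _
  have hle : ‖ξ‖ ^ 2 ≤ ‖ξ‖ * ‖w‖ := by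
    calc ‖ξ‖ ^ 2 = |(inner ℂ ξ w).im| := by
          rw [him, abs_mul, hc, one_mul, abs_of_nonneg (by positivity)]
      _ ≤ ‖inner ℂ ξ w‖ := Complex.abs_im_le_norm _
      _ ≤ ‖ξ‖ * ‖w‖ := norm_inner_le_norm _ _
  rcases (norm_nonneg ξ).eq_or_lt with h | h
  · rw [← h]; positivity
  · nlinarith

theorem IsSelfAdjoint.exists_mul_one_add_sq_eq {n : H →L[ℂ] H} (hn : IsSelfAdjoint n)
    (hn1 : ‖n‖ ≤ 1) :
    ∃ m : H →L[ℂ] H, IsSelfAdjoint m ∧ (∀ b, Commute n b → Commute m b) ∧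
      n * (m * m + 1) = 2 • m := by
  let g : ℝ → ℝ := fun t => t / (1 + √(1 - t ^ 2))
  have hg : Continuous g := by
    refine continuous_id.div (by fun_prop) fun t => ?_
    positivity
  refine ⟨cfc g n, cfc_predicate g n, fun b hb => hb.cfc_real g, ?_⟩
  have h1 : n * (cfc g n * cfc g n + 1) = cfc (fun t => t * (g t * g t + 1)) n := by
    rw [cfc_mul (fun t => t) (fun t => g t * g t + 1) n (by fun_prop) (by fun_prop), cfc_id' ℝ n,
      cfc_add .., cfc_mul .., cfc_const_one ℝ n]
  have h2 : 2 • cfc g n = cfc (fun t => 2 • g t) n := by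
    rw [cfc_smul ..]
  rw [h1, h2]
  refine cfc_congr fun t ht => ?_
  have ht1 : |t| ≤ 1 := by
    have := spectrum.norm_le_norm_mul_of_mem ht
    have h3 : ‖(1 : H →L[ℂ] H)‖ ≤ 1 := ContinuousLinearMap.norm_id_le
    rw [← Real.norm_eq_abs]
    nlinarith [norm_nonneg n, norm_nonneg (1 : H →L[ℂ] H)]
  have hs : √(1 - t ^ 2) ^ 2 = 1 - t ^ 2 := Real.sq_sqrt (by nlinarith [abs_le.1 ht1])
  have hpos : (1 + √(1 - t ^ 2)) ≠ 0 := by positivity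
  simp only [g, nsmul_eq_mul]
  push_cast
  field_simp
  linear_combination t * hs

theorem isUnit_unit_inv_mem {S : StarSubalgebra ℂ (H →L[ℂ] H)}
    (hS : IsClosed (S : Set (H →L[ℂ] H))) {x : H →L[ℂ] H} (h : IsUnit x) (hx : x ∈ S) :
    (↑h.unit⁻¹ : H →L[ℂ] H) ∈ S := by
  have := hS
  obtain ⟨y, hy⟩ := (StarSubalgebra.coe_isUnit S (a := ⟨x, hx⟩)).1 h
  have h1 : (y : S) * ↑y⁻¹ = 1 := y.mul_inv
  rw [hy] at h1
  have h2 : x * ((↑y⁻¹ : S) : H →L[ℂ] H) = 1 := congrArg Subtype.val h1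
  have h3 : (↑h.unit⁻¹ : H →L[ℂ] H) = ((↑y⁻¹ : S) : H →L[ℂ] H) :=
    h.mul_left_cancel (h.mul_val_inv.trans h2.symm)
  rw [h3]
  exact Subtype.property _

theorem exists_seq_norm_le_tendsto_of_countable (A : StarSubalgebra ℂ (H →L[ℂ] H))
    {n : H →L[ℂ] H} (hn : n ∈ Set.centralizer (Set.centralizer (A : Set (H →L[ℂ] H))))
    (hsa : IsSelfAdjoint n) (hn1 : ‖n‖ ≤ 1) {S : Set H} (hS : S.Countable) :
    ∃ R : ℕ → H →L[ℂ] H, (∀ k, R k ∈ A.topologicalClosure ∧ ‖R k‖ ≤ 2) ∧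
      ∀ ξ ∈ S, Tendsto (fun k => R k ξ) atTop (𝓝 (n ξ)) := by
  obtain ⟨m, hmsa, hmcomm, hmn⟩ := hsa.exists_mul_one_add_sq_eq hn1
  have hm : m ∈ Set.centralizer (Set.centralizer (A : Set (H →L[ℂ] H))) := fun b hb =>
    (hmcomm b (hn b hb).symm).eq.symm
  have hI : |Complex.I.im| = 1 := by simp
  have hI' : |(-Complex.I).im| = 1 := by simp
  obtain ⟨hu, -⟩ := hmsa.exists_resolvent hI
  obtain ⟨hu', -⟩ := hmsa.exists_resolvent hI'
  set r := (↑hu.unit⁻¹ : H →L[ℂ] H) with hr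
  set r' := (↑hu'.unit⁻¹ : H →L[ℂ] H) with hr'
  have hnr : n = r + r' := by
    have hX : (m + Complex.I • 1) * (m + (-Complex.I) • 1) = m * m + 1 := by
      simp [mul_add, add_mul, smul_smul]
      abel
    have hX' : (m + (-Complex.I) • 1) * (m + Complex.I • 1) = m * m + 1 := by
      simp [mul_add, add_mul, smul_smul]
    have h1 : r * (m + Complex.I • 1) = 1 := hu.val_inv_mul
    have h2 : r' * (m + (-Complex.I) • 1) = 1 := hu'.val_inv_mul
    have hU : IsUnit (m * m + 1) := hX ▸ hu.mul hu'
    refine hU.mul_right_cancel ?_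
    rw [hmn, add_mul]
    nth_rewrite 1 [← hX]
    rw [← hX', ← mul_assoc, ← mul_assoc, h1, h2]
    simp [two_smul]
    abel
  obtain ⟨a, ha, hlim⟩ := exists_seq_isSelfAdjoint_tendsto_of_countable A hm hmsa
    ((hS.image r).union (hS.image r'))
  choose h hnorm using fun k => (ha k).2.exists_resolvent hI
  choose h' hnorm' using fun k => (ha k).2.exists_resolvent hI'
  have hmem : ∀ k (c : ℂ), a k + c • 1 ∈ A.topologicalClosure := fun k c =>
    A.le_topologicalClosure (add_mem (ha k).1 (SMulMemClass.smul_mem _ (one_mem A)))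
  refine ⟨fun k => ↑(h k).unit⁻¹ + ↑(h' k).unit⁻¹, fun k => ⟨add_mem ?_ ?_, ?_⟩, fun ξ hξ => ?_⟩
  · exact isUnit_unit_inv_mem
      A.isClosed_topologicalClosure (h k) (hmem k _)
  · exact isUnit_unit_inv_mem
      A.isClosed_topologicalClosure (h' k) (hmem k _)
  · exact (norm_add_le _ _).trans (by linarith [hnorm k, hnorm' k])
  · rw [hnr]
    exact (tendsto_resolvent_apply hu h hnorm (hlim _ (Or.inl ⟨ξ, hξ, rfl⟩))).add
      (tendsto_resolvent_apply hu' h' hnorm' (hlim _ (Or.inr ⟨ξ, hξ, rfl⟩)))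

end BoundedApproximation

section SeparatingVectors

variable {H : Type*} [NormedAddCommGroup H] [InnerProductSpace ℂ H] [CompleteSpace H]

theorem star_mem_centralizer_starSubalgebra (A : StarSubalgebra ℂ (H →L[ℂ] H)) {c : H →L[ℂ] H}
    (hc : c ∈ Set.centralizer (A : Set (H →L[ℂ] H))) :
    star c ∈ Set.centralizer (A : Set (H →L[ℂ] H)) := by
  intro a ha
  have := congrArg star (hc (star a) (star_mem ha))
  simpa using this.symm

/-- The closed cyclic subspace generated by a vector under the commutant of `A`. -/
noncomputable def commutantCyclic (A : StarSubalgebra ℂ (H →L[ℂ] H)) (ξ : H) : Submodule ℂ H :=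
  ((Subalgebra.centralizer ℂ (A : Set (H →L[ℂ] H))).toSubmodule.map
    (ContinuousLinearMap.apply ℂ H ξ).toLinearMap).topologicalClosure

instance (A : StarSubalgebra ℂ (H →L[ℂ] H)) (ξ : H) : CompleteSpace (commutantCyclic A ξ) :=
  (Submodule.isClosed_topologicalClosure _).completeSpace_coe

theorem apply_mem_commutantCyclic (A : StarSubalgebra ℂ (H →L[ℂ] H)) (ξ : H) {c : H →L[ℂ] H}
    (hc : c ∈ Set.centralizer (A : Set (H →L[ℂ] H))) : c ξ ∈ commutantCyclic A ξ :=
  Submodule.le_topologicalClosure _ ⟨c, hc, rfl⟩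

theorem mapsTo_commutantCyclic (A : StarSubalgebra ℂ (H →L[ℂ] H)) (ξ : H) {c : H →L[ℂ] H}
    (hc : c ∈ Set.centralizer (A : Set (H →L[ℂ] H))) :
    ∀ v ∈ commutantCyclic A ξ, c v ∈ commutantCyclic A ξ := by
  intro v hv
  refine Set.MapsTo.closure ?_ c.continuous hv
  rintro _ ⟨d, hd, rfl⟩
  exact ⟨c * d, Set.mul_mem_centralizer hc hd, rfl⟩

theorem starProjection_commutantCyclic_mem (A : StarSubalgebra ℂ (H →L[ℂ] H)) (ξ : H) :
    (commutantCyclic A ξ).starProjection ∈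
      Set.centralizer (Set.centralizer (A : Set (H →L[ℂ] H))) := fun c hc =>
  commute_starProjection _ c (mapsTo_commutantCyclic A ξ hc)
    (mapsTo_commutantCyclic A ξ (star_mem_centralizer_starSubalgebra A hc))

theorem commutantCyclic_isOrtho (A : StarSubalgebra ℂ (H →L[ℂ] H)) {ξ η : H}
    (h : ∀ c ∈ Set.centralizer (A : Set (H →L[ℂ] H)), inner ℂ (c ξ) η = 0) :
    (commutantCyclic A ξ).IsOrtho (commutantCyclic A η) := by
  rw [Submodule.isOrtho_iff_le, commutantCyclic, commutantCyclic, Submodule.orthogonal_closure]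
  refine Submodule.topologicalClosure_minimal _ ?_ (Submodule.isClosed_orthogonal _)
  rintro _ ⟨c, hc, rfl⟩
  rw [Submodule.mem_orthogonal']
  rintro _ ⟨d, hd, rfl⟩
  have := h (star d * c) (Set.mul_mem_centralizer (star_mem_centralizer_starSubalgebra A hd) hc)
  rw [ContinuousLinearMap.star_eq_adjoint, mul_apply_eq_comp,
    ContinuousLinearMap.adjoint_inner_left] at this
  exact this

theorem countable_of_orthogonal_commutantCyclic (A : StarSubalgebra ℂ (H →L[ℂ] H))
    (ω : (H →L[ℂ] H) →ₗ[ℂ] ℂ) (hω1 : ω 1 = 1)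
    (hωpos : ∀ m ∈ Set.centralizer (Set.centralizer (A : Set (H →L[ℂ] H))), 0 ≤ ω (star m * m))
    (hωfaith : ∀ m ∈ Set.centralizer (Set.centralizer (A : Set (H →L[ℂ] H))),
      ω (star m * m) = 0 → m = 0) {S : Set H} (hS0 : ∀ ξ ∈ S, ξ ≠ 0)
    (hS : ∀ ξ ∈ S, ∀ η ∈ S, ξ ≠ η →
      ∀ c ∈ Set.centralizer (A : Set (H →L[ℂ] H)), inner ℂ (c ξ) η = 0) :
    S.Countable := by
  classical
  let e : S → H →L[ℂ] H := fun ξ => (commutantCyclic A (ξ : H)).starProjection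
  have heN : ∀ ξ, e ξ ∈ Subalgebra.centralizer ℂ
      (Set.centralizer (A : Set (H →L[ℂ] H))) := fun ξ => starProjection_commutantCyclic_mem A ξ
  have hproj : ∀ ξ, IsStarProjection (e ξ) := fun ξ => isStarProjection_starProjection
  have horth : OrthogonalIdempotents e := by
    refine ⟨fun ξ => (hproj ξ).isIdempotentElem, fun ξ η hne => ?_⟩
    exact (Submodule.starProjection_comp_starProjection_eq_zero_iff).2
      (commutantCyclic_isOrtho A (hS ξ ξ.2 η η.2 (fun h => hne (Subtype.ext h))))
  have hωe : ∀ ξ, 0 < (ω (e ξ)).re := by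
    intro ξ
    have h1 : star (e ξ) * e ξ = e ξ := by
      rw [(hproj ξ).isSelfAdjoint.star_eq, (hproj ξ).isIdempotentElem.eq]
    have h2 := hωpos _ (heN ξ)
    rw [h1] at h2
    refine lt_of_le_of_ne (Complex.le_def.1 h2).1 fun h3 => hS0 ξ ξ.2 ?_
    have h4 : e ξ = 0 := by
      refine hωfaith _ (heN ξ) ?_
      rw [h1]
      exact (Complex.ext h3 (Complex.le_def.1 h2).2).symm
    have h5 : e ξ (ξ : H) = ξ := Submodule.starProjection_eq_self_iff.2
      (apply_mem_commutantCyclic A (ξ : H) (c := 1) Set.one_mem_centralizer)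
    rw [← h5, h4]
    simp
  have hsum : ∀ F : Finset S, ∑ ξ ∈ F, (ω (e ξ)).re ≤ 1 := by
    intro F
    have hE : IsStarProjection (1 - ∑ ξ ∈ F, e ξ) := by
      refine IsStarProjection.one_sub ⟨horth.isIdempotentElem_sum, ?_⟩
      exact isSelfAdjoint_sum _ fun ξ _ => (hproj ξ).isSelfAdjoint
    have h2 := hωpos (1 - ∑ ξ ∈ F, e ξ)
      (sub_mem (one_mem (Subalgebra.centralizer ℂ _)) (sum_mem fun ξ _ => heN ξ))
    rw [hE.isSelfAdjoint.star_eq, hE.isIdempotentElem.eq, map_sub, hω1, map_sum] at h2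
    have h3 := (Complex.le_def.1 h2).1
    simp at h3
    linarith
  have hsupp := (summable_of_sum_le (fun ξ => (hωe ξ).le) hsum).countable_support
  have huniv : Function.support (fun ξ => (ω (e ξ)).re) = Set.univ :=
    Set.eq_univ_of_forall fun ξ => (hωe ξ).ne'
  rw [huniv, Set.countable_univ_iff] at hsupp
  exact Set.countable_coe_iff.1 hsupp

theorem exists_countable_cyclic_commutant (A : StarSubalgebra ℂ (H →L[ℂ] H))
    (ω : (H →L[ℂ] H) →ₗ[ℂ] ℂ) (hω1 : ω 1 = 1)
    (hωpos : ∀ m ∈ Set.centralizer (Set.centralizer (A : Set (H →L[ℂ] H))), 0 ≤ ω (star m * m))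
    (hωfaith : ∀ m ∈ Set.centralizer (Set.centralizer (A : Set (H →L[ℂ] H))),
      ω (star m * m) = 0 → m = 0) :
    ∃ S : Set H, S.Countable ∧ ∀ η : H,
      (∀ c ∈ Set.centralizer (A : Set (H →L[ℂ] H)), ∀ ξ ∈ S, inner ℂ (c ξ) η = 0) → η = 0 := by
  let 𝔽 : Set (Set H) := {S | (∀ ξ ∈ S, ξ ≠ 0) ∧ ∀ ξ ∈ S, ∀ η ∈ S, ξ ≠ η →
      ∀ c ∈ Set.centralizer (A : Set (H →L[ℂ] H)), inner ℂ (c ξ) η = 0}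
  obtain ⟨S, hS⟩ := zorn_subset 𝔽 (by
    intro c hc hchain
    refine ⟨⋃₀ c, ⟨?_, ?_⟩, fun s hs => Set.subset_sUnion_of_mem hs⟩
    · rintro ξ ⟨s, hs, hξ⟩
      exact (hc hs).1 ξ hξ
    · rintro ξ ⟨s, hs, hξ⟩ η ⟨t, ht, hη⟩
      rcases hchain.total hs ht with h | h
      · exact (hc ht).2 ξ (h hξ) η hη
      · exact (hc hs).2 ξ hξ η (h hη))
  refine ⟨S, countable_of_orthogonal_commutantCyclic A ω hω1 hωpos hωfaith hS.prop.1 hS.prop.2,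
    fun η hη => ?_⟩
  by_contra hne
  have hins : insert η S ∈ 𝔽 := by
    refine ⟨?_, ?_⟩
    · rintro ξ (rfl | hξ)
      exacts [hne, hS.prop.1 ξ hξ]
    · rintro ξ (rfl | hξ) ζ (rfl | hζ) hξζ c hc
      · exact absurd rfl hξζ
      · rw [← ContinuousLinearMap.adjoint_inner_right, ← inner_conj_symm,
          ← ContinuousLinearMap.star_eq_adjoint,
          hη _ (star_mem_centralizer_starSubalgebra A hc) ζ hζ, map_zero]
      · exact hη c hc ξ hξ
      · exact hS.prop.2 ξ hξ ζ hζ hξζ c hc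
  have hmem : η ∈ S := hS.le_of_ge hins (Set.subset_insert _ _) (Set.mem_insert _ _)
  exact hne (inner_self_eq_zero.1 (hη 1 Set.one_mem_centralizer η hmem))

theorem tendsto_apply_of_norm_le_of_total {R : ℕ → H →L[ℂ] H} {n : H →L[ℂ] H} {C : ℝ}
    (hR : ∀ k, ‖R k‖ ≤ C) {T : Set H}
    (hT : ∀ ξ ∈ T, Tendsto (fun k => R k ξ) atTop (𝓝 (n ξ)))
    (htot : ∀ η : H, (∀ ξ ∈ T, inner ℂ ξ η = 0) → η = 0) (ξ : H) :
    Tendsto (fun k => R k ξ) atTop (𝓝 (n ξ)) := by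
  let V : Submodule ℂ H :=
    { carrier := {ξ | Tendsto (fun k => R k ξ) atTop (𝓝 (n ξ))}
      add_mem' := fun h1 h2 => by simpa using h1.add h2
      zero_mem' := by simp
      smul_mem' := fun c ξ h => by simpa using h.const_smul c }
  have hV : V.topologicalClosure = ⊤ := by
    rw [Submodule.topologicalClosure_eq_top_iff, Submodule.eq_bot_iff]
    exact fun η hη => htot η fun ξ hξ => (Submodule.mem_orthogonal _ _).1 hη ξ (hT ξ hξ)
  have hξ : ξ ∈ closure (V : Set H) := by
    rw [← Submodule.topologicalClosure_coe, hV]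
    trivial
  have hC : 0 ≤ C := (norm_nonneg _).trans (hR 0)
  rw [Metric.tendsto_nhds]
  intro ε hε
  obtain ⟨ξ', hξ', hd⟩ := Metric.mem_closure_iff.1 hξ (ε / 2 / (C + ‖n‖ + 1)) (by positivity)
  filter_upwards [Metric.tendsto_nhds.1 hξ' (ε / 2) (by positivity)] with k hk
  rw [dist_eq_norm] at hk hd ⊢
  rw [lt_div_iff₀ (by positivity)] at hd
  have h1 : R k ξ - n ξ = R k (ξ - ξ') - n (ξ - ξ') + (R k ξ' - n ξ') := by
    simp only [map_sub]
    abel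
  have h2 := (R k).le_of_opNorm_le (hR k) (ξ - ξ')
  have h3 := n.le_opNorm (ξ - ξ')
  have h4 := norm_add_le (R k (ξ - ξ') - n (ξ - ξ')) (R k ξ' - n ξ')
  have h5 := norm_sub_le (R k (ξ - ξ')) (n (ξ - ξ'))
  rw [h1]
  nlinarith [norm_nonneg (ξ - ξ')]

/-- A version of Kaplansky's density theorem: in the presence of a faithful state, every element of
the bicommutant is the strong limit of a bounded sequence. -/
theorem exists_bounded_seq_tendsto_of_mem_bicommutant (A : StarSubalgebra ℂ (H →L[ℂ] H))
    (ω : (H →L[ℂ] H) →ₗ[ℂ] ℂ) (hω1 : ω 1 = 1)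
    (hωpos : ∀ m ∈ Set.centralizer (Set.centralizer (A : Set (H →L[ℂ] H))), 0 ≤ ω (star m * m))
    (hωfaith : ∀ m ∈ Set.centralizer (Set.centralizer (A : Set (H →L[ℂ] H))),
      ω (star m * m) = 0 → m = 0) {n : H →L[ℂ] H}
    (hn : n ∈ Set.centralizer (Set.centralizer (A : Set (H →L[ℂ] H)))) :
    ∃ (C : ℝ) (R : ℕ → H →L[ℂ] H), (∀ k, R k ∈ A) ∧ (∀ k, ‖R k‖ ≤ C) ∧
      ∀ ξ, Tendsto (fun k => R k ξ) atTop (𝓝 (n ξ)) := by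
  obtain ⟨S, hS, hStot⟩ := exists_countable_cyclic_commutant A ω hω1 hωpos hωfaith
  have contraction : ∀ m ∈ Set.centralizer (Set.centralizer (A : Set (H →L[ℂ] H))),
      IsSelfAdjoint m → ‖m‖ ≤ 1 → ∃ (C : ℝ) (R : ℕ → H →L[ℂ] H), (∀ k, R k ∈ A) ∧
        (∀ k, ‖R k‖ ≤ C) ∧ ∀ ξ, Tendsto (fun k => R k ξ) atTop (𝓝 (m ξ)) := by
    intro m hm hsa hm1
    obtain ⟨R', hR', hlim⟩ := exists_seq_norm_le_tendsto_of_countable A hm hsa hm1 hS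
    have key : ∀ k : ℕ, ∃ b ∈ A, dist (R' k) b < 1 / ((k : ℝ) + 1) := fun k =>
      Metric.mem_closure_iff.1 (hR' k).1 _ (by positivity)
    choose R hRA hRd using key
    have hR3 : ∀ k, ‖R k‖ ≤ 3 := by
      intro k
      have h1 : (1 : ℝ) / ((k : ℝ) + 1) ≤ 1 := by
        rw [div_le_one (by positivity)]
        linarith [(Nat.cast_nonneg k : (0 : ℝ) ≤ k)]
      have h2 := hRd k
      rw [dist_eq_norm, norm_sub_rev] at h2
      have h3 := norm_add_le (R k - R' k) (R' k)
      rw [sub_add_cancel] at h3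
      linarith [(hR' k).2]
    have hlimS : ∀ ξ ∈ S, Tendsto (fun k => R k ξ) atTop (𝓝 (m ξ)) := by
      intro ξ hξ
      have h0 : Tendsto (fun k => R k ξ - R' k ξ) atTop (𝓝 0) := by
        refine squeeze_zero_norm (a := fun k : ℕ => 1 / ((k : ℝ) + 1) * ‖ξ‖) (fun k => ?_) ?_
        · have h2 := (hRd k).le
          rw [dist_eq_norm, norm_sub_rev] at h2
          exact (R k - R' k).le_of_opNorm_le h2 ξ
        · simpa using tendsto_one_div_add_atTop_nhds_zero_nat.mul_const ‖ξ‖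
      simpa using h0.add (hlim ξ hξ)
    refine ⟨3, R, hRA, hR3, tendsto_apply_of_norm_le_of_total hR3
      (T := {v | ∃ c ∈ Set.centralizer (A : Set (H →L[ℂ] H)), ∃ ξ ∈ S, v = c ξ}) ?_ ?_⟩
    · rintro _ ⟨c, hc, ξ, hξ, rfl⟩
      have h1 : ∀ k, R k (c ξ) = c (R k ξ) := fun k => DFunLike.congr_fun (hc _ (hRA k)) ξ
      have h2 : m (c ξ) = c (m ξ) := (DFunLike.congr_fun (hm c hc) ξ).symm
      simp_rw [h1, h2]
      exact (c.continuous.tendsto _).comp (hlimS ξ hξ)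
    · exact fun η hη => hStot η fun c hc ξ hξ => hη _ ⟨c, hc, ξ, hξ, rfl⟩
  have selfadj : ∀ m ∈ Set.centralizer (Set.centralizer (A : Set (H →L[ℂ] H))),
      IsSelfAdjoint m → ∃ (C : ℝ) (R : ℕ → H →L[ℂ] H), (∀ k, R k ∈ A) ∧
        (∀ k, ‖R k‖ ≤ C) ∧ ∀ ξ, Tendsto (fun k => R k ξ) atTop (𝓝 (m ξ)) := by
    intro m hm hsa
    set t : ℝ := ‖m‖ + 1 with ht
    have htpos : 0 < t := by positivity
    obtain ⟨C, R, hRA, hRC, hlim⟩ := contraction (((t⁻¹ : ℝ) : ℂ) • m)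
      (Subalgebra.smul_mem (Subalgebra.centralizer ℂ _) hm _)
      (IsSelfAdjoint.smul (by simp [IsSelfAdjoint]) hsa) (by
        rw [norm_smul, Complex.norm_real, Real.norm_of_nonneg (by positivity),
          inv_mul_le_one₀ htpos]
        linarith)
    refine ⟨t * C, fun k => (t : ℂ) • R k, fun k => SMulMemClass.smul_mem _ (hRA k),
      fun k => ?_, fun ξ => ?_⟩
    · rw [norm_smul, Complex.norm_real, Real.norm_of_nonneg htpos.le]
      exact mul_le_mul_of_nonneg_left (hRC k) htpos.le
    · have := (hlim ξ).const_smul (t : ℂ)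
      simpa [smul_smul, htpos.ne'] using this
  have hstar : star n ∈ Subalgebra.centralizer ℂ (Set.centralizer (A : Set (H →L[ℂ] H))) := by
    intro c hc
    have := congrArg star (hn (star c) (star_mem_centralizer_starSubalgebra A hc))
    simpa using this.symm
  have hn' : n ∈ Subalgebra.centralizer ℂ (Set.centralizer (A : Set (H →L[ℂ] H))) := hn
  obtain ⟨C₁, R₁, hA₁, hC₁, hlim₁⟩ := selfadj (n + star n) (add_mem hn' hstar)
    (IsSelfAdjoint.add_star_self n)
  obtain ⟨C₂, R₂, hA₂, hC₂, hlim₂⟩ := selfadj (Complex.I • (n - star n))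
    (Subalgebra.smul_mem _ (sub_mem hn' hstar) _) (by
      simp [IsSelfAdjoint, ← smul_neg])
  refine ⟨1 / 2 * (C₁ + C₂), fun k => (1 / 2 : ℂ) • (R₁ k - Complex.I • R₂ k), fun k =>
    SMulMemClass.smul_mem _ (sub_mem (hA₁ k) (SMulMemClass.smul_mem _ (hA₂ k))), fun k => ?_,
    fun ξ => ?_⟩
  · have h1 := norm_sub_le (R₁ k) (Complex.I • R₂ k)
    rw [norm_smul Complex.I, Complex.norm_I, one_mul] at h1
    rw [norm_smul]
    norm_num
    linarith [hC₁ k, hC₂ k]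
  · have := ((hlim₁ ξ).sub ((hlim₂ ξ).const_smul Complex.I)).const_smul (1 / 2 : ℂ)
    have hval : (1 / 2 : ℂ) • ((n + star n) ξ - Complex.I • (Complex.I • (n - star n)) ξ) =
        n ξ := by
      rw [smul_apply, smul_smul, Complex.I_mul_I, add_apply, sub_apply]
      module
    rw [hval] at this
    exact this

end SeparatingVectors

section AlternatingWords

variable {R : Type*} [Ring R]

/-- `IsAltWord S T b a` says that `a` is a nonempty alternating product of elements of `S` and `T`
whose last factor is in `S` if `b` is true and in `T` if `b` is false. -/
inductive IsAltWord_s1 (S T : Set R) : Bool → R → Prop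
  | single {b : Bool} {m : R} (hm : m ∈ cond b S T) : IsAltWord_s1 S T b m
  | mul {b : Bool} {a m : R} (ha : IsAltWord_s1 S T (!b) a) (hm : m ∈ cond b S T) :
      IsAltWord_s1 S T b (a * m)

theorem IsAltWord_s1.exists_ofFn {S T : Set R} {b : Bool} {a : R} (h : IsAltWord_s1 S T b a) :
    ∃ (n : ℕ) (y : Fin (n + 1) → R) (c : Fin (n + 1) → Bool),
      (∀ i, (c i = true → y i ∈ S) ∧ (c i = false → y i ∈ T)) ∧
      (∀ i : Fin n, c i.castSucc ≠ c i.succ) ∧ c (Fin.last n) = b ∧ (List.ofFn y).prod = a := by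
  have hcond : ∀ {b : Bool} {m : R}, m ∈ cond b S T → (b = true → m ∈ S) ∧ (b = false → m ∈ T) := by
    rintro (_ | _) m hm <;> simpa using hm
  induction h with
  | @single b m hm =>
    exact ⟨0, fun _ => m, fun _ => b, fun _ => hcond hm, fun i => i.elim0, rfl, by simp⟩
  | @mul b a m _ hm ih =>
    obtain ⟨n, y, c, h1, h2, h3, h4⟩ := ih
    refine ⟨n + 1, Fin.snoc (α := fun _ => R) y m, Fin.snoc (α := fun _ => Bool) c b,
      fun i => ?_, fun i => ?_, ?_, ?_⟩
    · refine Fin.lastCases ?_ (fun j => ?_) i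
      · simpa only [Fin.snoc_last] using hcond hm
      · simpa only [Fin.snoc_castSucc] using h1 j
    · refine Fin.lastCases ?_ (fun j => ?_) i
      · rw [Fin.succ_last, Fin.snoc_last, Fin.snoc_castSucc, h3]
        exact Bool.not_ne_self b
      · rw [Fin.succ_castSucc, Fin.snoc_castSucc, Fin.snoc_castSucc]
        exact h2 j
    · rw [Fin.snoc_last]
    · rw [List.ofFn_succ', List.concat_eq_append, List.prod_append]
      simp only [Fin.snoc_castSucc, Fin.snoc_last, List.prod_singleton, h4]

variable [Algebra ℂ R]

theorem FreeOn.apply_isAltWord {φ : R →ₗ[ℂ] ℂ} {S T : Set R} (hfree : FreeOn φ S T) {b : Bool}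
    {a : R} (h : IsAltWord_s1 S T b a) : φ a = 0 := by
  obtain ⟨n, y, c, h1, h2, -, rfl⟩ := h.exists_ofFn
  exact hfree n y c h1 h2

/-- The elements `y` such that `φ` vanishes on `y` and on `a * y` for every alternating word `a`
to which a factor of type `b` may be appended. -/
def altKernel (φ : R →ₗ[ℂ] ℂ) (S T : Set R) (b : Bool) : Submodule ℂ R where
  carrier := {y | φ y = 0 ∧ ∀ a, IsAltWord_s1 S T (!b) a → φ (a * y) = 0}
  add_mem' := fun h1 h2 => ⟨by rw [map_add, h1.1, h2.1, add_zero], fun a ha => by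
    rw [mul_add, map_add, h1.2 a ha, h2.2 a ha, add_zero]⟩
  zero_mem' := by simp
  smul_mem' := fun c y h => ⟨by rw [map_smul, h.1, smul_zero], fun a ha => by
    rw [mul_smul_comm, map_smul, h.2 a ha, smul_zero]⟩

theorem FreeOn.mem_altKernel {φ : R →ₗ[ℂ] ℂ} {S T : Set R} (hfree : FreeOn φ S T) {b : Bool}
    {m : R} (hm : m ∈ cond b S T) : m ∈ altKernel φ S T b :=
  ⟨hfree.apply_isAltWord (.single hm), fun _ ha => hfree.apply_isAltWord (.mul ha hm)⟩

theorem mul_mem_altKernel {φ : R →ₗ[ℂ] ℂ} {S T : Set R} {b b' : Bool} (hb : b' = !b)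
    {m r : R} (hm : m ∈ cond b S T) (hr : r ∈ altKernel φ S T b') :
    m * r ∈ altKernel φ S T b := by
  subst hb
  refine ⟨hr.2 m ?_, fun a ha => ?_⟩
  · rw [Bool.not_not]
    exact .single hm
  · rw [← mul_assoc]
    refine hr.2 _ ?_
    rw [Bool.not_not]
    exact .mul ha hm

/-- The algebra generated by two idempotents `p` and `q` is spanned by `1`, `p` and the products of
the words `(q - β) (p - α) (q - β) ⋯ (q - β)` with `1` and `p` from both sides. -/
theorem mem_span_of_mem_adjoin_idempotents {p q : R} (hp : p * p = p) (hq : q * q = q) (α β : ℂ)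
    {s : Set R} (hs : s ⊆ {p, q}) {n : R} (hn : n ∈ Algebra.adjoin ℂ s) :
    n ∈ Submodule.span ℂ {y : R | ∃ d, (d = 1 ∨ d = p) ∧ (y = d ∨ ∃ j : ℕ,
      y = ((q - β • 1) * (p - α • 1)) ^ j * (q - β • 1) * d ∨
      y = p * (((q - β • 1) * (p - α • 1)) ^ j * (q - β • 1) * d))} := by
  set g : ℕ → R := fun j => ((q - β • 1) * (p - α • 1)) ^ j * (q - β • 1) with hg
  set X := Submodule.span ℂ {y : R | ∃ d, (d = 1 ∨ d = p) ∧ (y = d ∨ ∃ j : ℕ,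
      y = g j * d ∨ y = p * (g j * d))} with hX
  have hd : ∀ d, (d = 1 ∨ d = p) → d ∈ X := fun d h => Submodule.subset_span ⟨d, h, .inl rfl⟩
  have hgd : ∀ j d, (d = 1 ∨ d = p) → g j * d ∈ X := fun j d h =>
    Submodule.subset_span ⟨d, h, .inr ⟨j, .inl rfl⟩⟩
  have hpgd : ∀ j d, (d = 1 ∨ d = p) → p * (g j * d) ∈ X := fun j d h =>
    Submodule.subset_span ⟨d, h, .inr ⟨j, .inr rfl⟩⟩
  have hg0 : g 0 = q - β • 1 := by simp [hg]
  have hgs : ∀ j, g (j + 1) = (q - β • 1) * (p * g j) - α • ((q - β • 1) * g j) := by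
    intro j
    simp only [hg, pow_succ', mul_assoc, mul_sub, sub_mul, smul_mul_assoc, mul_smul_comm, one_mul,
      smul_sub, smul_smul]
    module
  have hqq : (q - β • 1) * (q - β • 1) = (1 - 2 * β) • (q - β • 1) + (β * (1 - β)) • (1 : R) := by
    simp only [mul_sub, sub_mul, smul_mul_assoc, mul_smul_comm, one_mul, mul_one, hq]
    module
  have hqg : ∀ j d, (d = 1 ∨ d = p) → (q - β • 1) * (g j * d) ∈ X := by
    intro j d h
    rcases j with _ | j
    · rw [← mul_assoc, hg0, hqq, add_mul, smul_mul_assoc, smul_mul_assoc, one_mul, ← hg0]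
      exact add_mem (X.smul_mem _ (hgd 0 d h)) (X.smul_mem _ (hd d h))
    · have : (q - β • 1) * (g (j + 1) * d) = (1 - 2 * β) • (g (j + 1) * d) +
          (β * (1 - β)) • (p * (g j * d) - α • (g j * d)) := by
        have h1 : (q - β • 1) * g (j + 1) =
            ((q - β • 1) * (q - β • 1)) * (p * g j - α • g j) := by
          rw [hgs, mul_assoc, mul_sub (q - β • 1) (p * g j), mul_smul_comm]
        have h2 : g (j + 1) = (q - β • 1) * (p * g j - α • g j) := by
          rw [hgs, mul_sub (q - β • 1) (p * g j), mul_smul_comm]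
        rw [← mul_assoc, h1, hqq, add_mul, smul_mul_assoc, ← h2, smul_mul_assoc, one_mul, add_mul,
          smul_mul_assoc, smul_mul_assoc, sub_mul, smul_mul_assoc, mul_assoc p]
      rw [this]
      exact add_mem (X.smul_mem _ (hgd _ d h))
        (X.smul_mem _ (sub_mem (hpgd j d h) (X.smul_mem _ (hgd j d h))))
  have hqX : ∀ v ∈ X, q * v ∈ X := by
    intro v hv
    have hsplit : ∀ w, (q - β • 1) * w ∈ X → w ∈ X → q * w ∈ X := by
      intro w h1 h2
      have : q * w = (q - β • 1) * w + β • w := by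
        simp [sub_mul]
      rw [this]
      exact add_mem h1 (X.smul_mem _ h2)
    induction hv using Submodule.span_induction with
    | mem y hy =>
      obtain ⟨d, h, rfl | ⟨j, rfl | rfl⟩⟩ := hy
      · refine hsplit _ ?_ (hd _ h)
        rw [← hg0]
        exact hgd 0 _ h
      · exact hsplit _ (hqg j d h) (hgd j d h)
      · refine hsplit _ ?_ (hpgd j d h)
        have : (q - β • 1) * (p * (g j * d)) =
            g (j + 1) * d + α • ((q - β • 1) * (g j * d)) := by
          rw [hgs]
          simp only [sub_mul _ _ d, smul_mul_assoc _ _ d, mul_assoc]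
          abel
        rw [this]
        exact add_mem (hgd _ d h) (X.smul_mem _ (hqg j d h))
    | zero => simp
    | add x y _ _ hx hy => rw [mul_add]; exact add_mem hx hy
    | smul c x _ hx => rw [mul_smul_comm]; exact X.smul_mem _ hx
  have hpX : ∀ v ∈ X, p * v ∈ X := by
    intro v hv
    induction hv using Submodule.span_induction with
    | mem y hy =>
      obtain ⟨d, h, rfl | ⟨j, rfl | rfl⟩⟩ := hy
      · refine hd _ (.inr ?_)
        rcases h with rfl | rfl
        exacts [mul_one _, hp]
      · exact hpgd j d h
      · rw [← mul_assoc, hp]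
        exact hpgd j d h
    | zero => simp
    | add x y _ _ hx hy => rw [mul_add]; exact add_mem hx hy
    | smul c x _ hx => rw [mul_smul_comm]; exact X.smul_mem _ hx
  have hall : ∀ v ∈ X, n * v ∈ X := by
    induction hn using Algebra.adjoin_induction with
    | mem y hy =>
      rcases hs hy with rfl | rfl
      exacts [hpX, hqX]
    | algebraMap c =>
      intro v hv
      rw [← Algebra.smul_def]
      exact X.smul_mem _ hv
    | add x y _ _ hx hy => exact fun v hv => by rw [add_mul]; exact add_mem (hx v hv) (hy v hv)
    | mul x y _ _ hx hy => exact fun v hv => by rw [mul_assoc]; exact hx _ (hy v hv)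
  simpa using hall 1 (hd 1 (.inl rfl))

/-- Let `p` and `q` be idempotents with `p - α ∈ S` and `q - β ∈ T`, and let `E` be the
`φ`-preserving conditional expectation onto the span of `p` and `1 - p`. Then
`φ (a * (n - E n) * y) = 0` for `n` in the algebra generated by `p` and `q`, provided `a` and `y`
are compatible with alternating words. -/
theorem apply_mul_mul_eq_of_mem_adjoin {φ : R →ₗ[ℂ] ℂ} {S T : Set R} {p q : R} (hp : p * p = p)
    (hq : q * q = q) {α β : ℂ} (hα0 : α ≠ 0) (hα1 : 1 - α ≠ 0) (hφ1 : φ 1 = 1) (hφp : φ p = α)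
    (hpS : p - α • 1 ∈ S) (hqT : q - β • 1 ∈ T) (hfree : FreeOn φ S T) {a y : R}
    (ha : ∀ r ∈ altKernel φ S T false, φ (a * r) = 0 ∧ φ (a * (p * r)) = 0)
    (hy : (q - β • 1) * y ∈ altKernel φ S T false)
    (hpy : (q - β • 1) * (p * y) ∈ altKernel φ S T false)
    {s : Set R} (hs : s ⊆ {p, q}) {n : R} (hn : n ∈ Algebra.adjoin ℂ s) :
    φ (a * n * y) = α⁻¹ * φ (p * n) * φ (a * p * y) +
      (1 - α)⁻¹ * φ ((1 - p) * n) * φ (a * (1 - p) * y) := by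
  have hword : ∀ (j : ℕ) (t : R), (q - β • 1) * t ∈ altKernel φ S T false →
      ((q - β • 1) * (p - α • 1)) ^ j * (q - β • 1) * t ∈ altKernel φ S T false := by
    intro j t ht
    induction j with
    | zero => simpa using ht
    | succ j ih =>
      rw [pow_succ', mul_assoc, mul_assoc, mul_assoc, ← mul_assoc _ (q - β • 1) t]
      exact mul_mem_altKernel rfl hqT (mul_mem_altKernel (b := true) rfl hpS ih)
  have hpr : ∀ r ∈ altKernel φ S T false, φ (p * r) = 0 := by
    intro r hr
    have h1 : φ ((p - α • 1) * r) = 0 := (mul_mem_altKernel (b := true) rfl hpS hr).1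
    rwa [sub_mul, map_sub, smul_mul_assoc, one_mul, map_smul, hr.1, smul_zero, sub_zero] at h1
  have hone : (q - β • 1) * 1 ∈ altKernel φ S T false := by
    rw [mul_one]
    exact hfree.mem_altKernel hqT
  have hone' : (q - β • 1) * p ∈ altKernel φ S T false := by
    have h1 := mul_mem_altKernel (b := false) rfl hqT (hfree.mem_altKernel (b := true) hpS)
    have h2 : (q - β • 1) * p = (q - β • 1) * (p - α • 1) + α • (q - β • 1) := by
      rw [mul_sub _ p, mul_smul_comm, mul_one, sub_add_cancel]
    rw [h2]
    exact add_mem h1 (Submodule.smul_mem _ _ (hfree.mem_altKernel (b := false) hqT))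
  have hspan := mem_span_of_mem_adjoin_idempotents hp hq α β hs hn
  clear hn
  induction hspan using Submodule.span_induction with
  | mem n hn' =>
    obtain ⟨d, hd, rfl | ⟨j, hj⟩⟩ := hn'
    · rcases hd with rfl | rfl
      · simp [mul_sub, sub_mul, hφ1, hφp, hα0, hα1]
      · simp [mul_sub, sub_mul, hφp, hα0, hp]
    · have hd1 : ((q - β • 1) * (p - α • 1)) ^ j * (q - β • 1) * d ∈ altKernel φ S T false := by
        apply hword
        rcases hd with rfl | rfl
        exacts [hone, hone']
      have hdy : ((q - β • 1) * (p - α • 1)) ^ j * (q - β • 1) * d * y ∈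
          altKernel φ S T false := by
        rw [mul_assoc]
        apply hword
        rcases hd with rfl | rfl
        · rwa [one_mul]
        · exact hpy
      rcases hj with rfl | rfl
      · rw [mul_assoc a, (ha _ hdy).1, sub_mul 1 p, one_mul, map_sub, hpr _ hd1, hd1.1]
        simp
      · rw [mul_assoc a, mul_assoc p, (ha _ hdy).2, sub_mul 1 p, one_mul,
          ← mul_assoc p p, hp, sub_self, hpr _ hd1]
        simp
  | zero => simp
  | add n m _ _ hn hm =>
    simp only [mul_add, add_mul (a * n), map_add, hn, hm]
    ring
  | smul c n _ hn =>
    simp only [mul_smul_comm, smul_mul_assoc, map_smul, hn, smul_eq_mul]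
    ring

theorem apply_pow_mul_pow_eq [StarRing R] {φ : R →ₗ[ℂ] ℂ} {V W : Set R} {p u x z v : R}
    {lam γ : ℂ} (h1V : 1 ∈ V) (huV : u ∈ V) (hWV : W ⊆ V) (hW : ∀ w ∈ W, φ w = 0)
    (hstaruu : star u * u = p) (hpu : p * u = 0) (hxp : x * p = x)
    (hv : v = star u * x)
    (hx : ∀ y ∈ V, star u * x * y ∈ W) (hx' : ∀ y ∈ V, u * star x * y ∈ W)
    (hz : ∀ y ∈ V, star u * (z - γ • (1 - p)) * y ∈ W)
    (hxx : ∀ y ∈ V, star u * (x * star x - lam • (1 - p)) * y ∈ W)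
    (hφstar : ∀ k, φ (star (v ^ (k + 1))) = starRingEnd ℂ (φ (v ^ (k + 1)))) (k l : ℕ) :
    φ (v ^ k * (star u * z * u) * star v ^ l) = if k = l then γ * lam ^ k * φ p else 0 := by
  have hpp : star p = p := by
    rw [← hstaruu]
    simp
  have hvs : star v = star x * u := by
    rw [hv]
    simp
  have hpow : ∀ k, ∀ w ∈ W, v ^ k * w ∈ W := by
    intro k w hw
    induction k with
    | zero => simpa using hw
    | succ k ih =>
      rw [pow_succ', mul_assoc, hv]
      rw [hv] at ih
      exact hx _ (hWV ih)
  have hupow : ∀ l, u * star v ^ l ∈ V := by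
    intro l
    induction l with
    | zero => simpa using huV
    | succ l ih =>
      have h := hWV (hx' _ ih)
      rwa [mul_assoc, ← mul_assoc (star x), ← hvs, ← pow_succ'] at h
  have hvp : v * p = v := by
    rw [hv, mul_assoc, hxp]
  have hpvs : p * star v = star v := by
    have := congrArg star hvp
    rwa [star_mul, hpp] at this
  have hvpow : ∀ k, φ (v ^ (k + 1)) = 0 := by
    intro k
    have h := hpow k _ (hx _ h1V)
    rw [mul_one, ← hv, ← pow_succ] at h
    exact hW _ h
  have hmid : ∀ (c : ℂ) (b : R), star u * b * u = star u * (b - c • (1 - p)) * u + c • p := by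
    intro c b
    have h0 : star u * (1 - p) * u = p := by
      rw [mul_assoc, sub_mul, hpu, one_mul, sub_zero, hstaruu]
    rw [mul_sub (star u) b, sub_mul, mul_smul_comm, smul_mul_assoc, h0, sub_add_cancel]
  have hred : ∀ (c : ℂ) (b : R), (∀ y ∈ V, star u * (b - c • (1 - p)) * y ∈ W) → ∀ k l,
      φ (v ^ k * (star u * b * u) * star v ^ l) = c * φ (v ^ k * p * star v ^ l) := by
    intro c b hb k l
    rw [hmid c b, mul_add, add_mul, map_add, mul_smul_comm, smul_mul_assoc, map_smul, smul_eq_mul]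
    have h := hW _ (hpow k _ (hb _ (hupow l)))
    rw [← mul_assoc _ u, ← mul_assoc, ← mul_assoc] at h
    rw [← mul_assoc (v ^ k), h, zero_add]
  have hp : ∀ k l, φ (v ^ k * p * star v ^ l) = if k = l then lam ^ k * φ p else 0 := by
    intro k
    induction k with
    | zero =>
      rintro (_ | l)
      · simp
      · rw [pow_zero, one_mul, pow_succ', ← mul_assoc, hpvs, ← pow_succ', ← star_pow, hφstar,
          hvpow, map_zero, if_neg (Nat.succ_ne_zero l).symm]
    | succ k ih =>
      rintro (_ | l)
      · rw [pow_zero, mul_one, pow_succ, mul_assoc, hvp, ← pow_succ, hvpow,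
          if_neg (Nat.succ_ne_zero k)]
      · have h : v ^ (k + 1) * p * star v ^ (l + 1) =
            v ^ k * (star u * (x * star x) * u) * star v ^ l := by
          have h' : star u * (x * star x) * u = v * p * star v := by
            rw [hvp, hvs, hv]
            simp only [mul_assoc]
          rw [pow_succ, pow_succ', h']
          simp only [mul_assoc]
        rw [h, hred lam _ hxx, ih]
        by_cases hkl : k = l
        · simp [hkl, pow_succ']
          ring
        · simp [hkl]
  rw [hred γ z hz, hp]
  split_ifs <;> ring

end AlternatingWords

/-- In the free product situation `(M₂(ℂ), ω_λ) ∗ (ℂ², τ_β)`, with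
`p = p₁₁`, `u = p₀₁`, `v = u* x`, `P = u* z u` and `ω_p = ω(p)⁻¹ ω` on the corner `pMp`,
one has `ω_p(v^k P (v*)^l) = δ_{kl} γ λ^k` for all `k, l ≥ 0`, where `γ = β(λ+1)`. -/
theorem freeProduct_corner_projection_moments
    {H : Type*} [NormedAddCommGroup H] [InnerProductSpace ℂ H] [CompleteSpace H]
    (M : VonNeumannAlgebra H)
    (ω : (H →L[ℂ] H) →ₗ[ℂ] ℂ)
    -- `ω` is a faithful normal state on `M`
    (hω1 : ω 1 = 1)
    (hωpos : ∀ m ∈ M, 0 ≤ ω (star m * m))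
    (hωfaith : ∀ m ∈ M, ω (star m * m) = 0 → m = 0)
    (hωnormal : ∀ (w : H →L[ℂ] H) (R : ℕ → H →L[ℂ] H) (c : ℝ),
      w ∈ M → (∀ k, R k ∈ M) → (∀ k, ‖R k‖ ≤ c) →
      (∀ ξ : H, Tendsto (fun k => R k ξ) atTop (𝓝 (w ξ))) →
      Tendsto (fun k => ω (R k)) atTop (𝓝 (ω w)))
    (lam β : ℝ) (hlam0 : 0 < lam) (hlam1 : lam < 1) (hβ0 : 0 < β) (hβ1 : β < 1)
    -- the matrix units `p_{ij}` spanning a copy of `M₂(ℂ)`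
    (pm : Fin 2 → Fin 2 → (H →L[ℂ] H))
    (hpmM : ∀ i j, pm i j ∈ M)
    (hpmstar : ∀ i j, star (pm i j) = pm j i)
    (hpmmul : ∀ i j k l, pm i j * pm k l = if j = k then pm i l else 0)
    (hpmone : pm 0 0 + pm 1 1 = 1)
    (hpmω : ∀ i j, ω (pm i j) =
      if i = j then ((lam ^ (j : ℕ) / (lam + 1) : ℝ) : ℂ) else 0)
    -- the projection `q` spanning, together with `1`, a copy of `ℂ²`
    (q : H →L[ℂ] H) (hqM : q ∈ M) (hqstar : star q = q) (hqidem : q * q = q)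
    (hqω : ω q = (β : ℂ))
    -- freeness of `A = span(p_{ij})` and `B = span{1, q}` with respect to `ω`
    (hfree : FreeOn ω
      {m | m ∈ Submodule.span ℂ {y : H →L[ℂ] H | ∃ i j, y = pm i j} ∧ ω m = 0}
      {m | m ∈ Submodule.span ℂ ({1, q} : Set (H →L[ℂ] H)) ∧ ω m = 0})
    (p u : H →L[ℂ] H) (hp : p = pm 1 1) (hu : u = pm 0 1)
    -- `N` is the von Neumann subalgebra generated by `p` and `q`
    (N : Set (H →L[ℂ] H)) (hN : N = Set.centralizer (Set.centralizer {p, q}))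
    -- the elements `x, z ∈ N` furnished by Voiculescu's description
    (x z : H →L[ℂ] H) (hxN : x ∈ N) (hzN : z ∈ N)
    (hxx : star x * x = p)
    (hxxle : (1 - p) * (x * star x) = x * star x)
    (hωx : ω x = 0)
    (hωxx : ω (x * star x) = ((lam / (lam + 1) : ℝ) : ℂ))
    (hzstar : star z = z) (hzidem : z * z = z)
    (hzle : (1 - p) * z = z) (hzx : z * x = x)
    (hωz : ω z = (β : ℂ))
    -- the isometry `v = u* x` of the corner `pMp`, and the corner state `ω_p`
    (v : H →L[ℂ] H) (hv : v = star u * x)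
    (P : H →L[ℂ] H) (hP : P = star u * z * u)
    (ωp : (H →L[ℂ] H) → ℂ) (hωp : ∀ m, ωp m = (ω p)⁻¹ * ω m) :
    ∀ k l : ℕ, ωp (v ^ k * P * (star v) ^ l) =
      if k = l then ((β * (lam + 1) : ℝ) : ℂ) * (lam : ℂ) ^ k else 0 := by
  have hM1 : (1 : H →L[ℂ] H) ∈ M := one_mem M
  have hMsmul : ∀ (c : ℂ) (m : H →L[ℂ] H), m ∈ M → c • m ∈ M := fun c m hm =>
    M.toStarSubalgebra.smul_mem hm c
  -- relations between the matrix units and between the elements of `N`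
  have hlam : (lam + 1 : ℂ) ≠ 0 := by
    exact_mod_cast (by positivity : (lam + 1 : ℝ) ≠ 0)
  have hlam' : (lam : ℂ) ≠ 0 := by exact_mod_cast hlam0.ne'
  obtain ⟨α, hα⟩ : ∃ α : ℂ, α = lam / (lam + 1) := ⟨_, rfl⟩
  have hα0 : α ≠ 0 := by
    rw [hα]
    exact div_ne_zero hlam' hlam
  have hα1' : 1 - α = 1 / (lam + 1) := by
    rw [hα]
    field_simp
    ring
  have hα1 : 1 - α ≠ 0 := by
    rw [hα1']
    exact one_div_ne_zero hlam
  have hpp : p * p = p := by simp [hp, hpmmul]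
  have hpstar : star p = p := by rw [hp, hpmstar]
  have hustar : star u = pm 1 0 := by rw [hu, hpmstar]
  have hpM : p ∈ M := hp ▸ hpmM 1 1
  have huM : u ∈ M := hu ▸ hpmM 0 1
  have hφp : ω p = α := by simp [hp, hpmω, hα]
  have hpx : p * x = 0 := by
    have h : p * x * star (p * x) = 0 := by
      have h1 : p * (x * star x) = 0 := by
        rw [← hxxle, ← mul_assoc, mul_sub, mul_one, hpp, sub_self, zero_mul]
      rw [star_mul, mul_assoc, ← mul_assoc x, ← mul_assoc, h1, zero_mul]
    exact (CStarRing.mul_star_self_eq_zero_iff _).1 h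
  have hxp : x * p = x := by
    have h : star (x * p - x) * (x * p - x) = 0 := by
      rw [star_sub, star_mul, hpstar]
      simp only [sub_mul, mul_sub, mul_assoc]
      rw [← mul_assoc (star x) x p, hxx, hpp, hpp]
      simp
    exact sub_eq_zero.1 ((CStarRing.star_mul_self_eq_zero_iff _).1 h)
  have hpxs : p * star x = star x := by
    have := congrArg star hxp
    rwa [star_mul, hpstar] at this
  have hpz : p * z = 0 := by
    rw [← hzle, ← mul_assoc, mul_sub, mul_one, hpp, sub_self, zero_mul]
  -- `N` and its dense *-subalgebra
  let A₀ : StarSubalgebra ℂ (H →L[ℂ] H) := StarAlgebra.adjoin ℂ {p, q}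
  have hA₀M : (A₀ : Set (H →L[ℂ] H)) ⊆ M := by
    have : A₀ ≤ M.toStarSubalgebra := by
      refine StarAlgebra.adjoin_le ?_
      rintro m (rfl | rfl)
      exacts [hpM, hqM]
    exact this
  have hNA₀ : N ⊆ Set.centralizer (Set.centralizer (A₀ : Set (H →L[ℂ] H))) := by
    rw [hN]
    exact Set.centralizer_subset (Set.centralizer_subset (StarAlgebra.subset_adjoin ℂ _))
  have hccM : Set.centralizer (Set.centralizer (A₀ : Set (H →L[ℂ] H))) ⊆ M := by
    rw [← M.centralizer_centralizer]
    exact Set.centralizer_subset (Set.centralizer_subset hA₀M)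
  have hNM : N ⊆ M := hNA₀.trans hccM
  have hA₀adj : ∀ n ∈ A₀, n ∈ Algebra.adjoin ℂ ({p, q} ∪ star {p, q} : Set (H →L[ℂ] H)) := by
    intro n hn
    rw [← StarAlgebra.adjoin_toSubalgebra]
    exact hn
  have hgen : ({p, q} ∪ star {p, q} : Set (H →L[ℂ] H)) ⊆ {p, q} := by
    rintro m (hm | hm)
    · exact hm
    · rcases hm with hm | hm
      · left
        rw [← star_star m, hm, hpstar]
      · right
        rw [Set.mem_singleton_iff] at hm ⊢
        rw [← star_star m, hm, hqstar]
  have hxM := hNM hxN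
  have hNstar : star x ∈ N := by
    rw [hN] at hxN ⊢
    intro c hc
    have hc' : star c ∈ Set.centralizer {p, q} := by
      rintro m (rfl | rfl)
      · have := congrArg star (hc m (by simp))
        simpa [hpstar] using this.symm
      · have := congrArg star (hc m (by simp))
        simpa [hqstar] using this.symm
    have := congrArg star (hxN _ hc')
    simpa using this.symm
  have hNmul : x * star x ∈ N := by
    rw [hN] at hxN hNstar ⊢
    exact Set.mul_mem_centralizer hxN hNstar
  -- `ω` is hermitian
  have hherm : ∀ m ∈ M, ω (star m) = starRingEnd ℂ (ω m) := by
    intro m hm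
    have h0 := (Complex.le_def.1 (hωpos m hm)).2
    have h1 := (Complex.le_def.1 (hωpos (1 + m) (add_mem hM1 hm))).2
    have h2 := (Complex.le_def.1 (hωpos (1 + Complex.I • m) (add_mem hM1 (hMsmul _ _ hm)))).2
    have e1 : star (1 + m) * (1 + m) = 1 + m + star m + star m * m := by
      simp only [star_add, star_one]
      noncomm_ring
    have e2 : star (1 + Complex.I • m) * (1 + Complex.I • m) =
        1 + Complex.I • m - Complex.I • star m + star m * m := by
      simp only [star_add, star_one, star_smul, add_mul, mul_add, smul_add, smul_mul_assoc,
        mul_smul_comm, one_mul, mul_one, Complex.star_def, Complex.conj_I, neg_smul, neg_mul,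
        smul_neg, smul_smul, Complex.I_mul_I, neg_neg, one_smul]
      abel
    rw [e1] at h1
    rw [e2] at h2
    simp [hω1] at h0 h1 h2
    apply Complex.ext
    · rw [Complex.conj_re]
      linarith
    · rw [Complex.conj_im]
      linarith
  -- freeness
  set S : Set (H →L[ℂ] H) :=
    {m | m ∈ Submodule.span ℂ {y : H →L[ℂ] H | ∃ i j, y = pm i j} ∧ ω m = 0} with hS
  set T : Set (H →L[ℂ] H) :=
    {m | m ∈ Submodule.span ℂ ({1, q} : Set (H →L[ℂ] H)) ∧ ω m = 0} with hT
  have hpmspan : ∀ i j, pm i j ∈ Submodule.span ℂ {y : H →L[ℂ] H | ∃ i j, y = pm i j} :=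
    fun i j => Submodule.subset_span ⟨i, j, rfl⟩
  have hpS : p - α • 1 ∈ S := by
    refine ⟨sub_mem (hp ▸ hpmspan 1 1) (Submodule.smul_mem _ _ ?_), ?_⟩
    · rw [← hpmone]
      exact add_mem (hpmspan 0 0) (hpmspan 1 1)
    · simp [hφp, hω1]
  have hqT : q - (β : ℂ) • 1 ∈ T := by
    refine ⟨sub_mem (Submodule.subset_span (by simp))
      (Submodule.smul_mem _ _ (Submodule.subset_span (by simp))), ?_⟩
    simp [hqω, hω1]
  have huS : u ∈ S := ⟨hu ▸ hpmspan 0 1, by simp [hu, hpmω]⟩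
  have husS : star u ∈ S := ⟨hustar ▸ hpmspan 1 0, by simp [hustar, hpmω]⟩
  have hSM : S ⊆ M := by
    have h : Submodule.span ℂ {y : H →L[ℂ] H | ∃ i j, y = pm i j} ≤
        Subalgebra.toSubmodule M.toStarSubalgebra.toSubalgebra := by
      refine Submodule.span_le.2 ?_
      rintro _ ⟨i, j, rfl⟩
      exact hpmM i j
    exact fun m hm => h hm.1
  have hTM : T ⊆ M := by
    have h : Submodule.span ℂ ({1, q} : Set (H →L[ℂ] H)) ≤
        Subalgebra.toSubmodule M.toStarSubalgebra.toSubalgebra := by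
      refine Submodule.span_le.2 ?_
      rintro _ (rfl | rfl)
      exacts [hM1, hqM]
    exact fun m hm => h hm.1
  have hwordM : ∀ {b a}, IsAltWord_s1 S T b a → a ∈ M := by
    have hcond : ∀ {b : Bool} {m : H →L[ℂ] H}, m ∈ cond b S T → m ∈ M := by
      rintro (_ | _) m hm
      exacts [hTM hm, hSM hm]
    intro b a h
    induction h with
    | single hm => exact hcond hm
    | mul _ hm ih => exact mul_mem ih (hcond hm)
  let V : Set (H →L[ℂ] H) := {y | y ∈ M ∧ (q - (β : ℂ) • 1) * y ∈ altKernel ω S T false ∧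
    (q - (β : ℂ) • 1) * (p * y) ∈ altKernel ω S T false}
  let W : Set (H →L[ℂ] H) := {y | y ∈ V ∧ y ∈ altKernel ω S T true}
  have hKq : ∀ r ∈ altKernel ω S T true, (q - (β : ℂ) • 1) * r ∈ altKernel ω S T false :=
    fun r hr => mul_mem_altKernel (b := false) rfl hqT hr
  -- the expectation formula extends from the *-algebra generated by `p` and `q` to `N`
  have hformula : ∀ a ∈ M, (∀ r ∈ altKernel ω S T false, ω (a * r) = 0 ∧ ω (a * (p * r)) = 0) →
      ∀ y ∈ V, ∀ n ∈ N, ω (a * n * y) = α⁻¹ * ω (p * n) * ω (a * p * y) +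
        (1 - α)⁻¹ * ω ((1 - p) * n) * ω (a * (1 - p) * y) := by
    intro a haM ha y hy n hn
    obtain ⟨C, R, hRA, hRC, hlim⟩ := exists_bounded_seq_tendsto_of_mem_bicommutant A₀ ω hω1
      (fun m hm => hωpos m (hccM hm)) (fun m hm => hωfaith m (hccM hm)) (hNA₀ hn)
    have htend : ∀ b ∈ M, ∀ d ∈ M,
        Tendsto (fun k => ω (b * R k * d)) atTop (𝓝 (ω (b * n * d))) := by
      intro b hb d hd
      refine hωnormal _ _ (‖b‖ * C * ‖d‖) (mul_mem (mul_mem hb (hNM hn)) hd)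
        (fun k => mul_mem (mul_mem hb (hA₀M (hRA k))) hd) (fun k => ?_) (fun ξ => ?_)
      · refine (norm_mul_le _ _).trans (mul_le_mul_of_nonneg_right ?_ (norm_nonneg _))
        exact (norm_mul_le _ _).trans (mul_le_mul_of_nonneg_left (hRC k) (norm_nonneg _))
      · exact (b.continuous.tendsto _).comp (hlim (d ξ))
    have htend1 : ∀ b ∈ M, Tendsto (fun k => ω (b * R k)) atTop (𝓝 (ω (b * n))) := by
      intro b hb
      simpa using htend b hb 1 hM1
    refine tendsto_nhds_unique (htend a haM y hy.1) ?_
    have hlhs : (fun k => ω (a * R k * y)) = fun k => α⁻¹ * ω (p * R k) * ω (a * p * y) +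
        (1 - α)⁻¹ * ω ((1 - p) * R k) * ω (a * (1 - p) * y) := funext fun k =>
      apply_mul_mul_eq_of_mem_adjoin hpp hqidem hα0 hα1 hω1 hφp hpS hqT hfree ha hy.2.1 hy.2.2
        hgen (hA₀adj _ (hRA k))
    rw [hlhs]
    exact (((htend1 p hpM).const_mul _).mul_const _).add
      (((htend1 (1 - p) (sub_mem hM1 hpM)).const_mul _).mul_const _)
  have hstep : ∀ s ∈ S, (s * p = 0 ∨ s * p = s) → (p * s = 0 ∨ p * s = s) → ∀ n ∈ N, ∀ c : ℂ,
      ω (p * n) = 0 → ω ((1 - p) * n) = c * (1 - α) → ∀ y ∈ V, s * (n - c • (1 - p)) * y ∈ W := by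
    intro s hs hsp hps n hn c h0 h1 y hy
    have hzero : ∀ a ∈ M, (∀ r ∈ altKernel ω S T false, ω (a * r) = 0 ∧ ω (a * (p * r)) = 0) →
        ω (a * (n - c • (1 - p)) * y) = 0 := by
      intro a haM ha
      rw [mul_sub a, sub_mul, map_sub, hformula a haM ha y hy n hn, h0, h1, mul_smul_comm,
        smul_mul_assoc, map_smul, smul_eq_mul]
      field_simp
      ring
    have hsr : ∀ r ∈ altKernel ω S T false, s * r ∈ altKernel ω S T true := fun r hr =>
      mul_mem_altKernel (b := true) rfl hs hr
    have hspr : ∀ r ∈ altKernel ω S T false, s * (p * r) ∈ altKernel ω S T true := by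
      intro r hr
      rw [← mul_assoc]
      rcases hsp with h | h
      · rw [h, zero_mul]
        exact zero_mem _
      · rw [h]
        exact hsr r hr
    have hK : s * (n - c • (1 - p)) * y ∈ altKernel ω S T true := by
      refine ⟨hzero s (hSM hs) fun r hr => ⟨(hsr r hr).1, (hspr r hr).1⟩, fun a ha => ?_⟩
      rw [← mul_assoc, ← mul_assoc]
      refine hzero _ (mul_mem (hwordM ha) (hSM hs)) fun r hr => ?_
      rw [mul_assoc, mul_assoc]
      exact ⟨(hsr r hr).2 a ha, (hspr r hr).2 a ha⟩
    refine ⟨⟨?_, hKq _ hK, ?_⟩, hK⟩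
    · exact mul_mem (mul_mem (hSM hs)
        (sub_mem (hNM hn) (hMsmul _ _ (sub_mem hM1 hpM)))) hy.1
    · rw [← mul_assoc p, ← mul_assoc p]
      rcases hps with h | h
      · rw [h]
        simp
      · rw [h]
        exact hKq _ hK
  have husteps : ∀ n ∈ N, ∀ c : ℂ, ω (p * n) = 0 → ω ((1 - p) * n) = c * (1 - α) → ∀ y ∈ V,
      star u * (n - c • (1 - p)) * y ∈ W :=
    hstep _ husS (.inl (by simp [hustar, hp, hpmmul])) (.inr (by simp [hustar, hp, hpmmul]))
  have husx : ∀ y ∈ V, star u * x * y ∈ W := by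
    intro y hy
    have := husteps x hxN 0 (by rw [hpx, map_zero])
      (by rw [sub_mul, one_mul, hpx, sub_zero, hωx, zero_mul]) y hy
    simpa using this
  have huxs : ∀ y ∈ V, u * star x * y ∈ W := by
    intro y hy
    have h0 : ω (star x) = 0 := by rw [hherm x hxM, hωx, map_zero]
    have := hstep u huS (.inr (by simp [hu, hp, hpmmul])) (.inl (by simp [hu, hp, hpmmul]))
      (star x) hNstar 0 (by rw [hpxs, h0])
      (by rw [sub_mul, one_mul, hpxs, sub_self, map_zero, zero_mul]) y hy
    simpa using this
  have husz := husteps z hzN ((β * (lam + 1) : ℝ) : ℂ) (by rw [hpz, map_zero]) (by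
    rw [hzle, hωz, hα1']
    push_cast
    field_simp)
  have husxx := husteps (x * star x) hNmul lam (by rw [← mul_assoc, hpx, zero_mul, map_zero]) (by
    rw [hxxle, hωxx, hα1']
    push_cast
    field_simp)
  have hone : (1 : H →L[ℂ] H) ∈ V := by
    have hp' : p = (p - α • 1) + α • 1 := by simp
    have hq1 : (q - (β : ℂ) • 1) * 1 ∈ altKernel ω S T false := by
      rw [mul_one]
      exact hfree.mem_altKernel hqT
    refine ⟨hM1, hq1, ?_⟩
    rw [mul_one, hp', mul_add, mul_smul_comm]
    exact add_mem (hKq _ (hfree.mem_altKernel (b := true) hpS)) (Submodule.smul_mem _ _ hq1)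
  have huV : u ∈ V := by
    refine ⟨huM, hKq _ (hfree.mem_altKernel (b := true) huS), ?_⟩
    have : p * u = 0 := by simp [hu, hp, hpmmul]
    rw [this, mul_zero]
    exact zero_mem _
  have hvM : v ∈ M := hv ▸ mul_mem (star_mem huM) hxM
  intro k l
  rw [hωp, hP, apply_pow_mul_pow_eq (lam := lam) hone huV (fun w hw => hw.1) (fun w hw => hw.2.1)
    (by rw [hustar, hu, hp, hpmmul, if_pos rfl]) (by simp [hu, hp, hpmmul]) hxp hv husx huxs husz
    husxx (fun k => hherm _ (pow_mem hvM _)) k l]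
  split_ifs
  · rw [hφp]
    field_simp
  · rw [mul_zero]
end
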